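/- Assume gcd(s+l,2l) = gcd(s,l) = d and d is even. Let i = p^{s−1}(p−1)(p^s − 1) and λ = p^{s+d−1}·[p^{s−1}(p−1)(p^s − 1) − 1]·(p^m − 1)/(2(p^d + 1)). Then the distinct supports of the codewords of Hamming weight i in C form a 2-(p^m, i, λ) design on the point set F_q: each such support has exactly i elements, and every 2-element subset of F_q is contained in exactly λ of the distinct supports. -/

import Mathlib

/-- `trp p r z = z + z^p + ⋯ + z^(p^(r-1))`, the trace form used for `Tr_r`. -/
def trp (p r : ℕ) {F : Type} [Field F] (z : F) : F :=
  ∑ i ∈ Finset.range r, z ^ p ^ i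

/-- The codeword `c(a,b,c,h)` of the code `C`, viewed as a function on `F_q = F`;
its value at `x` is `Tr_s(a x^(p^s+1)) + Tr_m(b x^(p^l+1) + c x) + h` (the values
lie in the prime field `F_p ⊆ F`). Here `m = 2s`. -/
def cword (p s l : ℕ) {F : Type} [Field F] (a b c : F) (h : ZMod p) : F → F :=
  fun x => trp p s (a * x ^ (p ^ s + 1)) + trp p (2 * s) (b * x ^ (p ^ l + 1) + c * x)
    + ZMod.cast h

/-- The support of the codeword `c(a,b,c,h)`; its cardinality is the Hamming weight. -/
def suppw (p s l : ℕ) {F : Type} [Field F] [Fintype F] [DecidableEq F]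
    (a b c : F) (h : ZMod p) : Finset F :=
  Finset.univ.filter fun x => cword p s l a b c h x ≠ 0

section Auxiliary

open Finset
open scoped ComplexConjugate

set_option linter.unusedSectionVars false

section AdditiveSets

variable {G : Type*} [AddCommGroup G]

lemma Finset.sum_add_right_of_mem (K : Finset G)
    (add : ∀ x ∈ K, ∀ y ∈ K, x + y ∈ K) (neg : ∀ x ∈ K, -x ∈ K) {u : G} (hu : u ∈ K)
    {M : Type*} [AddCommMonoid M] (f : G → M) :
    ∑ x ∈ K, f (x + u) = ∑ x ∈ K, f x := by
  refine Finset.sum_bij' (fun x _ => x + u) (fun x _ => x + -u) ?_ ?_ ?_ ?_ ?_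
  · exact fun x hx => add x hx u hu
  · exact fun x hx => add x hx _ (neg u hu)
  · intro x _; simp
  · intro x _; simp
  · intro x _; rfl

lemma Finset.card_fiber_of_additive [Fintype G] [DecidableEq G] {f : G → G}
    (hf : ∀ x y, f (x + y) = f x + f y) (x₀ : G) :
    #{x | f x = f x₀} = #{x | f x = 0} := by
  have hneg : f x₀ + f (-x₀) = 0 := by
    have h0 := hf 0 0
    rw [add_zero, left_eq_add] at h0
    rw [← hf, add_neg_cancel, h0]
  refine Finset.card_bij' (fun x _ => x + -x₀) (fun x _ => x + x₀) ?_ ?_ ?_ ?_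
  · intro x hx
    simp [hf, (Finset.mem_filter.1 hx).2, hneg]
  · intro x hx
    simp [hf, (Finset.mem_filter.1 hx).2]
  · intro x _; simp
  · intro x _; simp

lemma Finset.sum_comp_of_additive [Fintype G] [DecidableEq G] {f : G → G}
    (hf : ∀ x y, f (x + y) = f x + f y) (g : G → ℂ) :
    ∑ x, g (f x) = #{x | f x = 0} * ∑ y ∈ univ.image f, g y := by
  rw [Finset.sum_comp, Finset.mul_sum]
  refine Finset.sum_congr rfl fun y hy => ?_
  obtain ⟨x₀, -, rfl⟩ := Finset.mem_image.1 hy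
  rw [Finset.card_fiber_of_additive hf, nsmul_eq_mul]

lemma Finset.card_image_mul_card_of_additive [Fintype G] [DecidableEq G] {f : G → G}
    (hf : ∀ x y, f (x + y) = f x + f y) :
    #(univ.image f) * #{x | f x = 0} = Fintype.card G := by
  have := Finset.sum_comp_of_additive hf (fun _ => 1)
  simp only [sum_const, nsmul_eq_mul, mul_one, card_univ] at this
  rw [mul_comm]
  exact_mod_cast this.symm

lemma Finset.sum_mul_conj_sum (K : Finset G)
    (add : ∀ x ∈ K, ∀ y ∈ K, x + y ∈ K) (neg : ∀ x ∈ K, -x ∈ K) (f : G → ℂ) :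
    (∑ x ∈ K, f x) * conj (∑ x ∈ K, f x) =
      ∑ u ∈ K, ∑ x ∈ K, f (x + u) * conj (f x) := by
  rw [Finset.sum_comm, map_sum, Finset.mul_sum]
  refine Finset.sum_congr rfl fun x hx => ?_
  rw [← Finset.sum_mul, ← Finset.sum_add_right_of_mem K add neg hx f]
  simp only [add_comm]

lemma Finset.sum_addChar_eq_zero (K : Finset G)
    (add : ∀ x ∈ K, ∀ y ∈ K, x + y ∈ K) (neg : ∀ x ∈ K, -x ∈ K) (ψ : AddChar G ℂ)
    {u : G} (hu : u ∈ K) (hne : ψ u ≠ 1) : ∑ x ∈ K, ψ x = 0 := by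
  have key : (∑ x ∈ K, ψ x) * ψ u = ∑ x ∈ K, ψ x := by
    rw [Finset.sum_mul, ← Finset.sum_add_right_of_mem K add neg hu (fun x => ψ x)]
    simp only [AddChar.map_add_eq_mul]
  have : (∑ x ∈ K, ψ x) * (ψ u - 1) = 0 := by rw [mul_sub, key]; ring
  exact (mul_eq_zero.1 this).resolve_right (sub_ne_zero.2 hne)

end AdditiveSets

/-- An involution `bar` of a field, an automorphism `L` commuting with it, and a nontrivial
additive character invariant under both, such that `bar` restricts to the identity on the fixed
field of `L ∘ bar`, which contains a square root of `-1`. -/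
structure Twist (F : Type) [Field F] where
  bar : F ≃+* F
  L : F ≃+* F
  χ : AddChar F ℂ
  bar_bar : ∀ x, bar (bar x) = x
  comm : ∀ x, L (bar x) = bar (L x)
  χ_bar : ∀ x, χ (bar x) = χ x
  χ_L : ∀ x, χ (L x) = χ x
  χ_ne : χ ≠ 1
  two : (2 : F) ≠ 0
  fix : ∀ x, L (bar x) = x → bar x = x
  root : ∃ i, bar i = i ∧ L i = i ∧ i * i = -1

namespace Twist

variable {F : Type} [Field F] (t : Twist F)

/-- The quadratic polynomial map attached to the pair `(a, b)`. -/
def quad (a b x : F) : F := 2⁻¹ * a * (x * t.bar x) + b * (x * t.L x)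

/-- The self-adjoint additive map polarizing `quad`. -/
def polar (a b x : F) : F := a * t.bar x + b * t.L x + t.L.symm (b * x)

lemma χ_L_symm (x : F) : t.χ (t.L.symm x) = t.χ x := by
  rw [← t.χ_L, RingEquiv.apply_symm_apply]

lemma eq_zero_of_χ {w : F} (h : ∀ x, t.χ (x * w) = 1) : w = 0 := by
  by_contra hw
  refine t.χ_ne (DFunLike.ext _ _ fun x => ?_)
  have := h (x * w⁻¹)
  rwa [inv_mul_cancel_right₀ hw] at this

lemma polar_add (a b x y : F) : t.polar a b (x + y) = t.polar a b x + t.polar a b y := by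
  simp only [polar, map_add, mul_add]; ring

lemma polar_neg (a b x : F) : t.polar a b (-x) = -t.polar a b x := by
  simp only [polar, map_neg, mul_neg]; ring

lemma χ_quad_add {a : F} (ha : t.bar a = a) (b x u : F) :
    t.χ (t.quad a b (x + u)) =
      t.χ (t.quad a b x) * t.χ (t.quad a b u) * t.χ (t.polar a b u * x) := by
  have e : t.quad a b (x + u) = t.quad a b x + t.quad a b u +
      (2⁻¹ * a * (x * t.bar u) + 2⁻¹ * a * (u * t.bar x) + b * t.L u * x + b * u * t.L x) := by
    simp only [quad, map_add]; ring
  have h1 : t.χ (2⁻¹ * a * (u * t.bar x)) = t.χ (2⁻¹ * a * (x * t.bar u)) := by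
    rw [← t.χ_bar]
    congr 1
    simp only [map_mul, map_inv₀, map_ofNat, ha, t.bar_bar]
    ring
  have h2 : t.χ (b * u * t.L x) = t.χ (t.L.symm (b * u) * x) := by
    rw [← t.χ_L_symm]
    simp
  have h3 : t.polar a b u * x = (2⁻¹ * a * (x * t.bar u) + 2⁻¹ * a * (x * t.bar u)) +
      b * t.L u * x + t.L.symm (b * u) * x := by
    have := t.two
    simp only [polar]
    field_simp
    ring
  rw [e, h3]
  simp only [AddChar.map_add_eq_mul, h1, h2]

lemma χ_quad_eq_one {a : F} (ha : t.bar a = a) {b u : F} (hu : t.polar a b u = 0) :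
    t.χ (t.quad a b u) = 1 := by
  have h2 := t.two
  have hp : t.polar (2⁻¹ * a) (2⁻¹ * b) u = 0 := by
    have : t.polar (2⁻¹ * a) (2⁻¹ * b) u = 2⁻¹ * t.polar a b u := by
      simp only [polar, mul_assoc, map_mul, map_inv₀, map_ofNat]; ring
    rw [this, hu, mul_zero]
  have h := t.χ_quad_add (a := 2⁻¹ * a) (by rw [map_mul, map_inv₀, map_ofNat, ha]) (2⁻¹ * b) u u
  have e : t.quad (2⁻¹ * a) (2⁻¹ * b) (u + u) =
      t.quad (2⁻¹ * a) (2⁻¹ * b) u + t.quad (2⁻¹ * a) (2⁻¹ * b) u + t.quad a b u := by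
    simp only [quad, map_add]; field_simp; ring
  rw [hp, zero_mul, AddChar.map_zero_eq_one, mul_one, e, AddChar.map_add_eq_mul,
    AddChar.map_add_eq_mul] at h
  have hne : t.χ (t.quad (2⁻¹ * a) (2⁻¹ * b) u) ≠ 0 := by
    intro h0
    have := t.χ.map_add_eq_mul (t.quad (2⁻¹ * a) (2⁻¹ * b) u) (-t.quad (2⁻¹ * a) (2⁻¹ * b) u)
    rw [add_neg_cancel, h0, zero_mul, AddChar.map_zero_eq_one] at this
    exact one_ne_zero this
  exact mul_left_cancel₀ (mul_ne_zero hne hne) (by rw [h, mul_one])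

variable [Fintype F] [DecidableEq F]

/-- The kernel of `polar a b`. -/
def ker (a b : F) : Finset F := univ.filter fun x => t.polar a b x = 0

/-- The exponential sum of `quad a b` with linear term `c`. -/
noncomputable def expSum (a b c : F) : ℂ := ∑ x, t.χ (t.quad a b x + c * x)

@[simp] lemma mem_ker {a b x : F} : x ∈ t.ker a b ↔ t.polar a b x = 0 := by simp [ker]

lemma sum_χ_mul (w : F) : ∑ x, t.χ (x * w) = if w = 0 then (Fintype.card F : ℂ) else 0 := by
  split_ifs with h
  · simp [h]
  · have := (AddChar.IsPrimitive.of_ne_one t.χ_ne) h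
    have h2 := AddChar.sum_eq_zero_of_ne_one this
    simpa [AddChar.mulShift_apply, mul_comm] using h2

lemma expSum_polar {a : F} (ha : t.bar a = a) (b x₀ : F) :
    t.expSum a b (t.polar a b x₀) = t.expSum a b 0 * t.χ (-t.quad a b x₀) := by
  simp only [expSum, zero_mul, add_zero]
  rw [← Equiv.sum_comp (Equiv.addRight x₀) (fun x => t.χ (t.quad a b x)), Finset.sum_mul]
  refine Finset.sum_congr rfl fun x _ => ?_
  have : t.χ (t.quad a b x₀) * t.χ (-t.quad a b x₀) = 1 := by
    rw [← AddChar.map_add_eq_mul, add_neg_cancel, AddChar.map_zero_eq_one]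
  simp only [Equiv.coe_addRight, t.χ_quad_add ha, AddChar.map_add_eq_mul]
  linear_combination (-t.χ (t.quad a b x) * t.χ (t.polar a b x₀ * x)) * this

lemma χ_mul_conj (x : F) : t.χ x * conj (t.χ x) = 1 := by
  rw [← AddChar.map_neg_eq_conj, ← AddChar.map_add_eq_mul, add_neg_cancel,
    AddChar.map_zero_eq_one]

lemma expSum_mul_conj {a : F} (ha : t.bar a = a) (b : F) :
    t.expSum a b 0 * conj (t.expSum a b 0) = Fintype.card F * #(t.ker a b) := by
  simp only [expSum, zero_mul, add_zero]
  rw [Finset.sum_mul_conj_sum univ (by simp) (by simp)]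
  have : ∀ u, ∑ x, t.χ (t.quad a b (x + u)) * conj (t.χ (t.quad a b x)) =
      if t.polar a b u = 0 then (Fintype.card F : ℂ) else 0 := by
    intro u
    calc _ = t.χ (t.quad a b u) * ∑ x, t.χ (x * t.polar a b u) := by
          rw [Finset.mul_sum]
          refine Finset.sum_congr rfl fun x _ => ?_
          rw [t.χ_quad_add ha, mul_comm x]
          linear_combination (t.χ (t.quad a b u) * t.χ (t.polar a b u * x)) *
            t.χ_mul_conj (t.quad a b x)
      _ = _ := by
          rw [t.sum_χ_mul]
          split_ifs with h
          · rw [t.χ_quad_eq_one ha h, one_mul]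
          · simp
  rw [Finset.sum_congr rfl fun u _ => this u, ← Finset.sum_filter, Finset.sum_const, nsmul_eq_mul,
    mul_comm]
  rfl

lemma expSum_smul {u : F} (hb : t.bar u = u) (hL : t.L u = u) (hu : u ≠ 0) (a b c : F) :
    t.expSum (u * u * a) (u * u * b) (u * c) = t.expSum a b c := by
  simp only [expSum]
  rw [← Equiv.sum_comp (Equiv.mulLeft₀ u hu) (fun x => t.χ (t.quad a b x + c * x))]
  refine Finset.sum_congr rfl fun x _ => ?_
  congr 1
  simp only [quad, Equiv.mulLeft₀_apply, map_mul, hb, hL]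
  ring

lemma conj_expSum (a b : F) : conj (t.expSum a b 0) = t.expSum a b 0 := by
  obtain ⟨i, hb, hL, hi⟩ := t.root
  have hi0 : i ≠ 0 := by rintro rfl; simp at hi
  have h := t.expSum_smul hb hL hi0 a b 0
  rw [hi, mul_zero] at h
  nth_rewrite 1 [← h]
  rw [expSum, map_sum, expSum]
  refine Finset.sum_congr rfl fun x _ => ?_
  rw [← AddChar.map_neg_eq_conj]
  congr 1
  simp only [quad]
  ring

lemma expSum_sq {a : F} (ha : t.bar a = a) (b : F) :
    t.expSum a b 0 ^ 2 = Fintype.card F * #(t.ker a b) := by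
  rw [← t.expSum_mul_conj ha, conj_expSum, sq]

lemma card_image_polar_mul_card_ker (a b : F) :
    #(univ.image (t.polar a b)) * #(t.ker a b) = Fintype.card F :=
  Finset.card_image_mul_card_of_additive (t.polar_add a b)

lemma sum_expSum_mul_conj (a b : F) :
    ∑ c, t.expSum a b c * conj (t.expSum a b c) = (Fintype.card F : ℂ) ^ 2 := by
  have : ∀ c, t.expSum a b c * conj (t.expSum a b c) =
      ∑ u, ∑ x, t.χ (t.quad a b (x + u)) * conj (t.χ (t.quad a b x)) * t.χ (c * u) := by
    intro c
    rw [expSum, Finset.sum_mul_conj_sum univ (by simp) (by simp)]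
    refine Finset.sum_congr rfl fun u _ => Finset.sum_congr rfl fun x _ => ?_
    rw [mul_add, AddChar.map_add_eq_mul _ _ (c * x + c * u), AddChar.map_add_eq_mul _ (c * x),
      AddChar.map_add_eq_mul _ (t.quad a b x), map_mul (starRingEnd ℂ)]
    linear_combination (t.χ (t.quad a b (x + u)) * conj (t.χ (t.quad a b x)) * t.χ (c * u)) *
      t.χ_mul_conj (c * x)
  simp only [this]
  rw [Finset.sum_comm]
  have : ∀ u, ∑ c, ∑ x, t.χ (t.quad a b (x + u)) * conj (t.χ (t.quad a b x)) * t.χ (c * u) =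
      if u = 0 then (Fintype.card F : ℂ) ^ 2 else 0 := by
    intro u
    rw [Finset.sum_comm]
    simp only [← Finset.mul_sum, t.sum_χ_mul]
    split_ifs with h
    · simp [h, t.χ_mul_conj, sq]
    · simp
  simp [this]

lemma expSum_eq_zero {a : F} (ha : t.bar a = a) (b : F) {c : F}
    (hc : c ∉ univ.image (t.polar a b)) : t.expSum a b c = 0 := by
  have hN : ∀ c, t.expSum a b c * conj (t.expSum a b c) = (Complex.normSq (t.expSum a b c) : ℂ) :=
    fun c => Complex.mul_conj _
  have h1 : ∑ c, Complex.normSq (t.expSum a b c) = (Fintype.card F : ℝ) ^ 2 := by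
    have := t.sum_expSum_mul_conj a b
    simp only [hN] at this
    exact_mod_cast this
  have h2 : ∑ c ∈ univ.image (t.polar a b), Complex.normSq (t.expSum a b c) =
      (Fintype.card F : ℝ) ^ 2 := by
    have : ∀ c ∈ univ.image (t.polar a b), Complex.normSq (t.expSum a b c) =
        Fintype.card F * #(t.ker a b) := by
      intro c hc
      obtain ⟨x₀, -, rfl⟩ := Finset.mem_image.1 hc
      have h := t.expSum_mul_conj ha b
      have e : t.expSum a b (t.polar a b x₀) * conj (t.expSum a b (t.polar a b x₀)) =
          t.expSum a b 0 * conj (t.expSum a b 0) := by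
        rw [t.expSum_polar ha, map_mul]
        linear_combination (t.expSum a b 0 * conj (t.expSum a b 0)) *
          t.χ_mul_conj (-t.quad a b x₀)
      rw [h, hN] at e
      exact_mod_cast e
    rw [Finset.sum_congr rfl this, Finset.sum_const, nsmul_eq_mul,
      ← t.card_image_polar_mul_card_ker a b]
    push_cast
    ring
  have h3 : ∑ c ∈ (univ.image (t.polar a b))ᶜ, Complex.normSq (t.expSum a b c) = 0 := by
    have := Finset.sum_add_sum_compl (univ.image (t.polar a b))
      (fun c => Complex.normSq (t.expSum a b c))
    linarith
  have := (Finset.sum_eq_zero_iff_of_nonneg fun c _ => Complex.normSq_nonneg _).1 h3 c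
    (Finset.mem_compl.2 hc)
  exact Complex.normSq_eq_zero.1 this

/-- The fixed field of `bar`. -/
def E : Finset F := univ.filter fun x => t.bar x = x

/-- The fixed field of `L ∘ bar`. -/
def R : Finset F := univ.filter fun x => t.L (t.bar x) = x

@[simp] lemma mem_E {x : F} : x ∈ t.E ↔ t.bar x = x := by simp [E]

lemma mem_R {x : F} : x ∈ t.R ↔ t.bar x = x ∧ t.L x = x := by
  simp only [R, mem_filter, mem_univ, true_and]
  refine ⟨fun h => ⟨t.fix x h, ?_⟩, fun h => by rw [h.1, h.2]⟩
  rwa [t.fix x h] at h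

lemma zero_mem_R : (0 : F) ∈ t.R := by simp [mem_R]

lemma R_add : ∀ x ∈ t.R, ∀ y ∈ t.R, x + y ∈ t.R := by
  simp only [mem_R]
  intro x hx y hy
  simp [hx, hy]

lemma R_neg : ∀ x ∈ t.R, -x ∈ t.R := by
  simp only [mem_R]
  intro x hx
  simp [hx]

lemma sum_E_χ_mul {w : F} (hw : t.bar w = w) :
    ∑ x ∈ t.E, t.χ (x * w) = if w = 0 then (#t.E : ℂ) else 0 := by
  split_ifs with h
  · simp [h]
  · obtain ⟨x, hx⟩ : ∃ x, t.χ (x * 2) ≠ 1 := by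
      by_contra! hall
      exact t.two (t.eq_zero_of_χ hall)
    have key := Finset.sum_addChar_eq_zero t.E (by simp +contextual) (by simp +contextual)
      (AddChar.mulShift t.χ w) (u := (x + t.bar x) * w⁻¹)
      (by simp only [mem_E, map_mul, map_add, t.bar_bar, map_inv₀, hw, add_comm])
    simp only [AddChar.mulShift_apply, mul_comm w] at key
    refine key ?_
    rwa [inv_mul_cancel_right₀ h, AddChar.map_add_eq_mul, t.χ_bar,
      ← AddChar.map_add_eq_mul, ← mul_two]

/-- The elements `β` for which `x ↦ χ (x * β)` is trivial on the fixed field of `L ∘ bar`. -/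
def IsTriv (β : F) : Prop := ∀ c ∈ t.R, t.χ (c * β) = 1

lemma sum_R_χ_of_isTriv {w : F} (h : t.IsTriv w) : ∑ x ∈ t.R, t.χ (x * w) = #t.R := by
  rw [Finset.sum_congr rfl h]
  simp

lemma sum_R_χ_of_not_isTriv {w : F} (h : ¬ t.IsTriv w) : ∑ x ∈ t.R, t.χ (x * w) = 0 := by
  simp only [IsTriv, not_forall] at h
  obtain ⟨u, hu, hne⟩ := h
  have key := Finset.sum_addChar_eq_zero t.R t.R_add t.R_neg (AddChar.mulShift t.χ w) hu
  simp only [AddChar.mulShift_apply, mul_comm w] at key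
  exact key hne

lemma polar_zero_right (a x : F) : t.polar a 0 x = a * t.bar x := by
  simp [polar]

lemma sum_expSum_E (P : ℕ) (hE : #t.E = P) : ∑ a ∈ t.E, t.expSum (2 * a) 0 0 = P := by
  simp only [expSum]
  rw [Finset.sum_comm]
  have : ∀ x, ∑ a ∈ t.E, t.χ (t.quad (2 * a) 0 x + 0 * x) = if x = 0 then (P : ℂ) else 0 := by
    intro x
    have h : ∀ a, t.quad (2 * a) 0 x + 0 * x = a * (x * t.bar x) := by
      intro a
      have := t.two
      simp only [quad]
      field_simp
      ring
    simp only [h]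
    rw [t.sum_E_χ_mul (by rw [map_mul, t.bar_bar, mul_comm]), hE]
    simp
  rw [Finset.sum_congr rfl fun x _ => this x]
  simp

/-- The Hermitian forms `x ↦ a * x * bar x` have the same exponential sum for all `a ≠ 0`. -/
lemma expSum_hermitian (P : ℕ) (hE : #t.E = P) (hF : Fintype.card F = P ^ 2) {a : F}
    (ha : t.bar a = a) (ha0 : a ≠ 0) : t.expSum a 0 0 = -P := by
  have hsq : ∀ a ∈ t.E.erase 0, t.expSum (2 * a) 0 0 ^ 2 = (P : ℂ) ^ 2 := by
    intro a ha
    simp only [mem_erase, mem_E] at ha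
    have hk : t.ker (2 * a) 0 = {0} := by
      ext x
      simp [polar_zero_right, ha.1, t.two]
    rw [t.expSum_sq (by rw [map_mul, ha.2, map_ofNat]), hk, hF]
    simp
  have hval : ∀ a ∈ t.E.erase 0, t.expSum (2 * a) 0 0 = P ∨ t.expSum (2 * a) 0 0 = -P :=
    fun a ha => sq_eq_sq_iff_eq_or_eq_neg.1 (hsq a ha)
  have hsum : ∑ a ∈ t.E.erase 0, (t.expSum (2 * a) 0 0 + P) = 0 := by
    have h0 : (0 : F) ∈ t.E := by simp
    have h := t.sum_expSum_E P hE
    rw [← Finset.add_sum_erase _ _ h0] at h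
    have hz : t.expSum (2 * 0) 0 0 = (P : ℂ) ^ 2 := by
      simp [expSum, quad, hF]
    rw [hz] at h
    rw [Finset.sum_add_distrib, Finset.sum_const, Finset.card_erase_of_mem h0, hE, nsmul_eq_mul,
      Nat.cast_sub (hE ▸ Finset.card_pos.2 ⟨0, h0⟩)]
    push_cast
    linear_combination h
  have hre : ∑ a ∈ t.E.erase 0, (t.expSum (2 * a) 0 0 + P).re = 0 := by
    rw [← Complex.re_sum, hsum, Complex.zero_re]
  have hnonneg : ∀ a ∈ t.E.erase 0, 0 ≤ (t.expSum (2 * a) 0 0 + P).re := by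
    intro a ha
    rcases hval a ha with h | h <;> rw [h] <;> simp
  have hmem : 2⁻¹ * a ∈ t.E.erase 0 := by
    simp only [mem_erase, mem_E, map_mul, map_inv₀, map_ofNat, ha, and_true]
    exact mul_ne_zero (inv_ne_zero t.two) ha0
  have := (Finset.sum_eq_zero_iff_of_nonneg hnonneg).1 hre _ hmem
  have h2 : 2 * (2⁻¹ * a) = a := mul_inv_cancel_left₀ t.two a
  have hv := hval _ hmem
  rw [h2] at this hv
  rcases hv with h | h
  · rw [h] at this ⊢
    simp only [Complex.add_re, Complex.natCast_re] at this
    have hP : (P : ℝ) = 0 := by linarith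
    have : (P : ℂ) = 0 := by exact_mod_cast hP
    simp [this]
  · exact h

/-- The quadratic Gauss sum over the fixed field of `L ∘ bar`. -/
noncomputable def gauss (β : F) : ℂ := ∑ c ∈ t.R, t.χ (2⁻¹ * (c * c) * β)

lemma two_mem_R : (2 : F) ∈ t.R := t.mem_R.2 ⟨map_ofNat _ _, map_ofNat _ _⟩

lemma R_mul {x y : F} (hx : x ∈ t.R) (hy : y ∈ t.R) : x * y ∈ t.R := by
  rw [mem_R] at *
  simp [hx, hy]

lemma R_inv {x : F} (hx : x ∈ t.R) : x⁻¹ ∈ t.R := by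
  rw [mem_R] at *
  simp [hx]

lemma gauss_of_isTriv {β : F} (h : t.IsTriv β) : t.gauss β = #t.R := by
  rw [gauss, Finset.sum_congr rfl fun c hc =>
    h _ (t.R_mul (t.R_inv t.two_mem_R) (t.R_mul hc hc))]
  simp

lemma conj_gauss (β : F) : conj (t.gauss β) = t.gauss β := by
  obtain ⟨i, hb, hL, hi⟩ := t.root
  have hiR : i ∈ t.R := t.mem_R.2 ⟨hb, hL⟩
  have hi0 : i ≠ 0 := by rintro rfl; simp at hi
  rw [gauss, map_sum]
  refine Finset.sum_bij' (fun c _ => i * c) (fun c _ => i⁻¹ * c) ?_ ?_ ?_ ?_ ?_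
  · exact fun c hc => t.R_mul hiR hc
  · exact fun c hc => t.R_mul (t.R_inv hiR) hc
  · intro c _; simp [hi0]
  · intro c _; simp [hi0]
  · intro c _
    rw [← AddChar.map_neg_eq_conj]
    congr 1
    linear_combination (-2⁻¹ * c * c * β) * hi

lemma gauss_sq {β : F} (h : ¬ t.IsTriv β) : t.gauss β ^ 2 = #t.R := by
  classical
  have key : t.gauss β * conj (t.gauss β) = #t.R := by
    rw [gauss, Finset.sum_mul_conj_sum t.R t.R_add t.R_neg]
    have : ∀ u ∈ t.R, ∑ x ∈ t.R, t.χ (2⁻¹ * ((x + u) * (x + u)) * β) *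
        conj (t.χ (2⁻¹ * (x * x) * β)) = if u = 0 then (#t.R : ℂ) else 0 := by
      intro u hu
      have e : ∀ x, t.χ (2⁻¹ * ((x + u) * (x + u)) * β) * conj (t.χ (2⁻¹ * (x * x) * β)) =
          t.χ (2⁻¹ * (u * u) * β) * t.χ (x * (u * β)) := by
        intro x
        rw [← AddChar.map_neg_eq_conj, ← AddChar.map_add_eq_mul, ← AddChar.map_add_eq_mul]
        congr 1
        have := t.two
        field_simp
        ring
      rw [Finset.sum_congr rfl fun x _ => e x, ← Finset.mul_sum]
      split_ifs with h2
      · simp [h2]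
      · rw [sum_R_χ_of_not_isTriv, mul_zero]
        refine fun h1 => h fun c hc => ?_
        have := h1 (c * u⁻¹) (t.R_mul hc (t.R_inv hu))
        rwa [mul_assoc, inv_mul_cancel_left₀ h2] at this
    rw [Finset.sum_congr rfl this]
    simp [zero_mem_R]
  rw [conj_gauss] at key
  rw [sq, key]

lemma sum_gauss (P : ℕ) (hE : #t.E = P) : ∑ β ∈ t.E, t.gauss β = P := by
  simp only [gauss]
  rw [Finset.sum_comm]
  have : ∀ c ∈ t.R, ∑ β ∈ t.E, t.χ (2⁻¹ * (c * c) * β) = if c = 0 then (P : ℂ) else 0 := by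
    intro c hc
    simp only [mul_comm (2⁻¹ * (c * c)) _]
    rw [t.sum_E_χ_mul, hE]
    · simp [t.two]
    · rw [mem_R] at hc
      rw [map_mul, map_inv₀, map_ofNat, map_mul, hc.1]
  rw [Finset.sum_congr rfl this]
  simp [zero_mem_R]

open scoped Classical in
lemma card_isTriv_mul (P : ℕ) (hE : #t.E = P) :
    #{β ∈ t.E | t.IsTriv β} * #t.R = P := by
  have h1 : ∑ β ∈ t.E, ∑ c ∈ t.R, t.χ (c * β) = #{β ∈ t.E | t.IsTriv β} * #t.R := by
    have : ∀ β ∈ t.E, ∑ c ∈ t.R, t.χ (c * β) = if t.IsTriv β then (#t.R : ℂ) else 0 := by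
      intro β _
      split_ifs with h
      · exact t.sum_R_χ_of_isTriv h
      · exact t.sum_R_χ_of_not_isTriv h
    rw [Finset.sum_congr rfl this, ← Finset.sum_filter, Finset.sum_const, nsmul_eq_mul]
  rw [Finset.sum_comm] at h1
  have : ∀ c ∈ t.R, ∑ β ∈ t.E, t.χ (c * β) = if c = 0 then (P : ℂ) else 0 := by
    intro c hc
    simp only [mul_comm c]
    rw [t.sum_E_χ_mul (t.mem_R.1 hc).1, hE]
  rw [Finset.sum_congr rfl this] at h1
  simp only [Finset.sum_ite_eq', zero_mem_R, if_true] at h1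
  exact_mod_cast h1.symm

lemma χ_quad_of_bar_eq {b : F} (hb : t.bar b = b) (x : F) :
    t.χ (t.quad (-(b + t.L.symm b)) b x) =
      t.χ (t.quad (-b) 0 (x - t.L (t.bar x))) := by
  have h1 : t.χ (2⁻¹ * b * (t.bar x * t.L (t.bar x))) = t.χ (2⁻¹ * b * (x * t.L x)) := by
    rw [← t.χ_bar]
    simp only [map_mul, map_inv₀, map_ofNat, hb, t.bar_bar, ← t.comm]
  have h2 : t.χ (2⁻¹ * b * -(t.L (t.bar x) * t.L x)) =
      t.χ (2⁻¹ * t.L.symm b * -(x * t.bar x)) := by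
    rw [← t.χ_L_symm]
    simp only [map_mul, map_inv₀, map_ofNat, map_neg, RingEquiv.symm_apply_apply]
    ring_nf
  have e1 : t.quad (-(b + t.L.symm b)) b x = -(2⁻¹ * b * (x * t.bar x)) +
      2⁻¹ * t.L.symm b * -(x * t.bar x) + 2⁻¹ * b * (x * t.L x) + 2⁻¹ * b * (x * t.L x) := by
    have := t.two
    simp only [quad]
    field_simp
    ring
  have e2 : t.quad (-b) 0 (x - t.L (t.bar x)) = -(2⁻¹ * b * (x * t.bar x)) +
      2⁻¹ * b * -(t.L (t.bar x) * t.L x) + 2⁻¹ * b * (t.bar x * t.L (t.bar x)) +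
      2⁻¹ * b * (x * t.L x) := by
    have := t.two
    simp only [quad, map_sub, ← t.comm, t.bar_bar]
    field_simp
    ring
  rw [e1, e2]
  simp only [AddChar.map_add_eq_mul, h1, h2]

lemma sub_additive (x y : F) :
    (x + y) - t.L (t.bar (x + y)) = (x - t.L (t.bar x)) + (y - t.L (t.bar y)) := by
  simp only [map_add]; ring

lemma card_sub_eq_zero : #{x | x - t.L (t.bar x) = 0} = #t.R := by
  congr 1
  ext x
  simp only [R, mem_filter, mem_univ, true_and, sub_eq_zero]
  exact eq_comm

lemma χ_mul_sub {c : F} (hc : c ∈ t.R) (x : F) : t.χ (c * (x - t.L (t.bar x))) = 1 := by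
  rw [mem_R] at hc
  have h : t.χ (c * t.L (t.bar x)) = t.χ (c * x) := by
    nth_rewrite 1 [← hc.2, ← hc.1]
    rw [← map_mul, ← map_mul, t.χ_L, t.χ_bar]
  rw [mul_sub, sub_eq_add_neg, AddChar.map_add_eq_mul, AddChar.map_neg_eq_conj, h, t.χ_mul_conj]

open scoped Classical in
lemma image_sub : univ.image (fun x => x - t.L (t.bar x)) = univ.filter t.IsTriv := by
  refine Finset.eq_of_subset_of_card_le ?_ ?_
  · intro z hz
    obtain ⟨x, -, rfl⟩ := Finset.mem_image.1 hz
    simp only [mem_filter, mem_univ, true_and]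
    exact fun c hc => t.χ_mul_sub hc x
  · have h1 := Finset.card_image_mul_card_of_additive
      (f := fun x => x - t.L (t.bar x)) t.sub_additive
    rw [card_sub_eq_zero] at h1
    have h2 : #(univ.filter t.IsTriv) * #t.R = Fintype.card F := by
      have h : ∑ w, ∑ c ∈ t.R, t.χ (c * w) = #(univ.filter t.IsTriv) * #t.R := by
        have : ∀ w, ∑ c ∈ t.R, t.χ (c * w) = if t.IsTriv w then (#t.R : ℂ) else 0 := by
          intro w
          split_ifs with h
          · exact t.sum_R_χ_of_isTriv h
          · exact t.sum_R_χ_of_not_isTriv h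
        rw [Finset.sum_congr rfl fun w _ => this w, ← Finset.sum_filter, Finset.sum_const,
          nsmul_eq_mul]
      rw [Finset.sum_comm] at h
      have : ∀ c, ∑ w, t.χ (c * w) = if c = 0 then (Fintype.card F : ℂ) else 0 := by
        intro c
        simp only [mul_comm c]
        exact t.sum_χ_mul c
      rw [Finset.sum_congr rfl fun c _ => this c] at h
      simp only [Finset.sum_ite_eq', zero_mem_R, if_true] at h
      exact_mod_cast h.symm
    refine le_of_mul_le_mul_right (h2.trans h1.symm).le ?_
    exact Finset.card_pos.2 ⟨0, t.zero_mem_R⟩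

lemma expSum_of_bar_eq (P : ℕ) (hE : #t.E = P) (hF : Fintype.card F = P ^ 2) {b : F}
    (hb : t.bar b = b) (hb0 : b ≠ 0) :
    t.expSum (-(b + t.L.symm b)) b 0 = -P * t.gauss b⁻¹ := by
  classical
  have hnb : t.bar (-b) = -b := by rw [map_neg, hb]
  calc t.expSum (-(b + t.L.symm b)) b 0
      = ∑ x, t.χ (t.quad (-b) 0 (x - t.L (t.bar x))) := by
        simp only [expSum, zero_mul, add_zero, t.χ_quad_of_bar_eq hb]
    _ = #t.R * ∑ z with t.IsTriv z, t.χ (t.quad (-b) 0 z) := by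
        rw [Finset.sum_comp_of_additive t.sub_additive (fun z => t.χ (t.quad (-b) 0 z)),
          image_sub, card_sub_eq_zero]
    _ = ∑ z, t.χ (t.quad (-b) 0 z) * ∑ c ∈ t.R, t.χ (c * z) := by
        rw [Finset.mul_sum, Finset.sum_filter]
        refine Finset.sum_congr rfl fun z _ => ?_
        split_ifs with h
        · rw [t.sum_R_χ_of_isTriv h, mul_comm]
        · rw [t.sum_R_χ_of_not_isTriv h, mul_zero]
    _ = ∑ c ∈ t.R, t.expSum (-b) 0 c := by
        simp only [Finset.mul_sum, expSum, AddChar.map_add_eq_mul]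
        exact Finset.sum_comm
    _ = -P * t.gauss b⁻¹ := by
        rw [gauss, Finset.mul_sum]
        refine Finset.sum_congr rfl fun c hc => ?_
        rw [mem_R] at hc
        have hp : t.polar (-b) 0 (-(c * b⁻¹)) = c := by
          rw [polar_zero_right, map_neg, map_mul, map_inv₀, hb, hc.1]
          field_simp
        have hq : -t.quad (-b) 0 (-(c * b⁻¹)) = 2⁻¹ * (c * c) * b⁻¹ := by
          have := t.two
          simp only [quad, map_neg, map_mul, map_inv₀, hb, hc.1]
          field_simp
          ring
        have h := t.expSum_polar hnb 0 (-(c * b⁻¹))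
        rw [hp, hq, t.expSum_hermitian P hE hF hnb (neg_ne_zero.2 hb0)] at h
        exact h

lemma polar_one_eq_zero {a b : F} :
    t.polar a b 1 = 0 ↔ a = -(b + t.L.symm b) := by
  simp only [polar, map_one, mul_one]
  constructor
  · intro h; linear_combination h
  · rintro rfl; ring

lemma L_symm_bar (x : F) : t.L.symm (t.bar x) = t.bar (t.L.symm x) := by
  rw [RingEquiv.symm_apply_eq, t.comm, RingEquiv.apply_symm_apply]

lemma bar_eq_of_bar_add {b : F} (h : t.bar (b + t.L.symm b) = b + t.L.symm b) : t.bar b = b := by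
  have h1 : t.L (t.bar b - b) = -(t.bar b - b) := by
    have := congrArg t.L h
    simp only [map_add, ← t.L_symm_bar, RingEquiv.apply_symm_apply] at this
    rw [map_sub]
    linear_combination this
  have h2 : t.bar (t.bar b - b) = -(t.bar b - b) := by
    rw [map_sub, t.bar_bar]; ring
  have h3 := t.fix (t.bar b - b) (by rw [h2, map_neg, h1, neg_neg])
  rw [h2] at h3
  have h4 : 2 * (t.bar b - b) = 0 := by linear_combination -h3
  exact sub_eq_zero.1 ((mul_eq_zero.1 h4).resolve_left t.two)

lemma bar_add_L_symm {b : F} (hb : t.bar b = b) :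
    t.bar (-(b + t.L.symm b)) = -(b + t.L.symm b) := by
  rw [map_neg, map_add, ← t.L_symm_bar, hb]

lemma expSum_scale {x : F} (hx : x ≠ 0) (a b : F) :
    t.expSum (a * (x * t.bar x)) (b * (x * t.L x)) 0 = t.expSum a b 0 := by
  simp only [expSum, zero_mul, add_zero]
  rw [← Equiv.sum_comp (Equiv.mulLeft₀ x hx) (fun y => t.χ (t.quad a b y))]
  refine Finset.sum_congr rfl fun y _ => ?_
  congr 1
  simp only [quad, Equiv.mulLeft₀_apply, map_mul]
  ring

lemma polar_scale (a b x y : F) :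
    t.polar (a * (x * t.bar x)) (b * (x * t.L x)) y = x * t.polar a b (x * y) := by
  simp only [polar, map_mul, RingEquiv.symm_apply_apply]
  ring

lemma card_ker_scale {x : F} (hx : x ≠ 0) (a b : F) :
    #(t.ker (a * (x * t.bar x)) (b * (x * t.L x))) = #(t.ker a b) := by
  refine Finset.card_equiv (Equiv.mulLeft₀ x hx) fun y => ?_
  simp [polar_scale, hx]

/-- The parameters `(a, b)` with `a` fixed by `bar`, except `(0, 0)`. -/
def params : Finset (F × F) := (t.E ×ˢ univ).erase (0, 0)

lemma mem_params {w : F × F} : w ∈ t.params ↔ w ≠ 0 ∧ t.bar w.1 = w.1 := by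
  simp [params, Prod.mk_zero_zero]

lemma sum_expSum_params (P : ℕ) (hE : #t.E = P) (hF : Fintype.card F = P ^ 2) :
    ∑ w ∈ t.params, t.expSum w.1 w.2 0 = (P : ℂ) ^ 3 - (P : ℂ) ^ 2 := by
  have h0 : ((0, 0) : F × F) ∈ t.E ×ˢ univ := by simp
  have h := Finset.add_sum_erase _ (fun w : F × F => t.expSum w.1 w.2 0) h0
  have hz : t.expSum 0 0 0 = (P : ℂ) ^ 2 := by simp [expSum, quad, hF]
  simp only [hz] at h
  rw [params, eq_sub_iff_add_eq', h]
  simp only [expSum]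
  rw [Finset.sum_comm]
  have : ∀ x, ∑ w ∈ t.E ×ˢ univ, t.χ (t.quad w.1 w.2 x + 0 * x) =
      if x = 0 then (P : ℂ) ^ 3 else 0 := by
    intro x
    rw [Finset.sum_product]
    have e : ∀ a b, t.χ (t.quad a b x + 0 * x) =
        t.χ (a * (2⁻¹ * (x * t.bar x))) * t.χ (b * (x * t.L x)) := by
      intro a b
      rw [← AddChar.map_add_eq_mul]
      congr 1
      simp only [quad]
      ring
    simp only [e, ← Finset.mul_sum, ← Finset.sum_mul, t.sum_χ_mul]
    split_ifs with h1 h2 h2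
    · simp [h2, hE, hF]; ring
    · simp [h2] at h1
    · simp [h2] at h1
    · simp
  rw [Finset.sum_congr rfl fun x _ => this x]
  simp

lemma zero_mem_ker (a b : F) : 0 ∈ t.ker a b := by simp [polar]

lemma mul_bar_ne_zero {x : F} (hx : x ≠ 0) : x * t.bar x ≠ 0 :=
  mul_ne_zero hx ((map_ne_zero t.bar).2 hx)

lemma mul_L_ne_zero {x : F} (hx : x ≠ 0) : x * t.L x ≠ 0 :=
  mul_ne_zero hx ((map_ne_zero t.L).2 hx)

lemma bar_mul_bar (x : F) : t.bar (x * t.bar x) = x * t.bar x := by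
  rw [map_mul, t.bar_bar, mul_comm]

lemma scale_of_mem_ker {w : F × F} (hw : w ∈ t.params) {x : F} (hx : x ≠ 0)
    (h : x ∈ t.ker w.1 w.2) :
    t.bar (w.2 * (x * t.L x)) = w.2 * (x * t.L x) ∧ w.2 * (x * t.L x) ≠ 0 ∧
      w.1 * (x * t.bar x) = -(w.2 * (x * t.L x) + t.L.symm (w.2 * (x * t.L x))) := by
  rw [mem_params] at hw
  have h1 : w.1 * (x * t.bar x) = -(w.2 * (x * t.L x) + t.L.symm (w.2 * (x * t.L x))) := by
    rw [← polar_one_eq_zero, polar_scale, mul_one, t.mem_ker.1 h, mul_zero]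
  have h2 : t.bar (w.1 * (x * t.bar x)) = w.1 * (x * t.bar x) := by
    rw [map_mul, hw.2, bar_mul_bar]
  refine ⟨t.bar_eq_of_bar_add ?_, fun h0 => hw.1 ?_, h1⟩
  · rw [h1, map_neg, neg_inj] at h2
    exact h2
  · rw [h0, map_zero, add_zero, neg_zero] at h1
    exact Prod.ext ((mul_eq_zero.1 h1).resolve_right (t.mul_bar_ne_zero hx))
      ((mul_eq_zero.1 h0).resolve_right (t.mul_L_ne_zero hx))

lemma card_ker_of_bar_eq (P : ℕ) (hP : P ≠ 0) (hE : #t.E = P) (hF : Fintype.card F = P ^ 2) {b : F}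
    (hb : t.bar b = b) (hb0 : b ≠ 0) :
    (#(t.ker (-(b + t.L.symm b)) b) : ℂ) = t.gauss b⁻¹ ^ 2 := by
  have h := t.expSum_sq (t.bar_add_L_symm hb) b
  rw [t.expSum_of_bar_eq P hE hF hb hb0, hF] at h
  have hP' : (P : ℂ) ^ 2 ≠ 0 := by simp [hP]
  refine mul_left_cancel₀ hP' ?_
  push_cast at h
  rw [← h]
  ring

lemma card_ker_eq_or (P r : ℕ) (hE : #t.E = P) (hR : #t.R = r) (hF : Fintype.card F = P ^ 2)
    {w : F × F} (hw : w ∈ t.params) :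
    #(t.ker w.1 w.2) = 1 ∨ #(t.ker w.1 w.2) = r ∨ #(t.ker w.1 w.2) = r ^ 2 := by
  classical
  refine or_iff_not_imp_left.2 fun h => ?_
  have hP : P ≠ 0 := by
    rw [← hE]; exact (Finset.card_pos.2 ⟨0, by simp⟩).ne'
  obtain ⟨x, hx, hx0⟩ : ∃ x ∈ t.ker w.1 w.2, x ≠ 0 := by
    by_contra! hc
    exact h (Finset.card_eq_one.2 ⟨0, Finset.eq_singleton_iff_unique_mem.2
      ⟨t.zero_mem_ker _ _, hc⟩⟩)
  obtain ⟨h1, h2, h3⟩ := t.scale_of_mem_ker hw hx0 hx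
  have hk := t.card_ker_of_bar_eq P hP hE hF h1 h2
  rw [← h3, t.card_ker_scale hx0] at hk
  by_cases ht : t.IsTriv (w.2 * (x * t.L x))⁻¹
  · rw [t.gauss_of_isTriv ht, hR] at hk
    exact Or.inr (by exact_mod_cast hk)
  · rw [t.gauss_sq ht, hR] at hk
    exact Or.inl (by exact_mod_cast hk)

/-- The contribution of each nonzero element of the kernel to the sum over degenerate parameters. -/
noncomputable def degWeight (P : ℕ) (w : F × F) : ℂ :=
  (1 + t.expSum w.1 w.2 0 / P) / (#(t.ker w.1 w.2) - 1)

lemma sum_degenerate_eq (P : ℕ) :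
    ∑ w ∈ t.params with #(t.ker w.1 w.2) ≠ 1, (1 + t.expSum w.1 w.2 0 / P) =
      (Fintype.card F - 1) *
        ∑ b ∈ t.E.erase 0, t.degWeight P (-(b + t.L.symm b), b) := by
  have key : ∀ x ∈ (univ : Finset F).erase 0,
      ∑ w ∈ t.params with t.polar w.1 w.2 x = 0, t.degWeight P w =
        ∑ b ∈ t.E.erase 0, t.degWeight P (-(b + t.L.symm b), b) := by
    intro x hx
    have hx0 : x ≠ 0 := Finset.ne_of_mem_erase hx
    have hxb := t.mul_bar_ne_zero hx0
    have hxL := t.mul_L_ne_zero hx0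
    refine Finset.sum_nbij' (fun w => w.2 * (x * t.L x))
      (fun b => (-(b + t.L.symm b) / (x * t.bar x), b / (x * t.L x))) ?_ ?_ ?_ ?_ ?_
    · intro w hw
      rw [mem_filter, ← mem_ker] at hw
      obtain ⟨h1, h2, -⟩ := t.scale_of_mem_ker hw.1 hx0 hw.2
      exact Finset.mem_erase.2 ⟨h2, t.mem_E.2 h1⟩
    · intro b hb
      rw [Finset.mem_erase, mem_E] at hb
      rw [mem_filter, mem_params]
      refine ⟨⟨fun h => ?_, ?_⟩, ?_⟩
      · have := (Prod.ext_iff.1 h).2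
        simp only [Prod.snd_zero, div_eq_zero_iff] at this
        exact this.elim hb.1 hxL
      · simp only [map_div₀, t.bar_add_L_symm hb.2, bar_mul_bar]
      · have h := t.polar_scale (-(b + t.L.symm b) / (x * t.bar x)) (b / (x * t.L x)) x 1
        rw [div_mul_cancel₀ _ hxb, div_mul_cancel₀ _ hxL, t.polar_one_eq_zero.2 rfl, mul_one] at h
        exact (mul_eq_zero.1 h.symm).resolve_left hx0
    · intro w hw
      rw [mem_filter, ← mem_ker] at hw
      obtain ⟨-, -, h3⟩ := t.scale_of_mem_ker hw.1 hx0 hw.2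
      refine Prod.ext ?_ ?_
      · simp only [← h3]
        exact mul_div_cancel_right₀ _ hxb
      · exact mul_div_cancel_right₀ _ hxL
    · intro b _
      exact div_mul_cancel₀ _ hxL
    · intro w hw
      rw [mem_filter, ← mem_ker] at hw
      obtain ⟨-, -, h3⟩ := t.scale_of_mem_ker hw.1 hx0 hw.2
      simp only [degWeight, ← h3, t.expSum_scale hx0, t.card_ker_scale hx0]
  have h := Finset.sum_congr rfl key
  rw [Finset.sum_const, Finset.card_erase_of_mem (mem_univ _), Finset.card_univ, nsmul_eq_mul,
    Nat.cast_sub Fintype.card_pos, Nat.cast_one] at h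
  rw [← h]
  simp only [Finset.sum_filter]
  rw [Finset.sum_comm]
  refine Finset.sum_congr rfl fun w _ => ?_
  rw [← Finset.sum_filter, Finset.sum_const, nsmul_eq_mul]
  have hk : #{x ∈ univ.erase 0 | t.polar w.1 w.2 x = 0} = #(t.ker w.1 w.2) - 1 := by
    rw [← Finset.card_erase_of_mem (t.zero_mem_ker w.1 w.2)]
    congr 1
    ext x
    simp
  have hpos : 1 ≤ #(t.ker w.1 w.2) := Finset.card_pos.2 ⟨0, t.zero_mem_ker _ _⟩
  rw [hk, Nat.cast_sub hpos, Nat.cast_one, degWeight]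
  split_ifs with h1
  · have : (#(t.ker w.1 w.2) : ℂ) - 1 ≠ 0 := by
      rw [sub_ne_zero]
      exact_mod_cast h1
    field_simp
  · rw [not_not] at h1
    simp [h1]

lemma sum_degWeight (P r : ℕ) (hr : 2 ≤ r) (hP : P ≠ 0) (hE : #t.E = P) (hR : #t.R = r)
    (hF : Fintype.card F = P ^ 2) :
    ∑ b ∈ t.E.erase 0, t.degWeight P (-(b + t.L.symm b), b) =
      P / r - (P / r - 1) / (r + 1) := by
  classical
  have hP' : (P : ℂ) ≠ 0 := by simp [hP]
  have hr0 : (r : ℂ) ≠ 0 := by simp; omega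
  have hr1 : (r : ℂ) - 1 ≠ 0 := by
    rw [sub_ne_zero]; exact_mod_cast (by omega : r ≠ 1)
  have hr2 : (r : ℂ) + 1 ≠ 0 := by exact_mod_cast (by omega : r + 1 ≠ 0)
  have h1 : ∑ b ∈ t.E.erase 0, t.degWeight P (-(b + t.L.symm b), b) =
      ∑ β ∈ t.E.erase 0, if t.IsTriv β then -1 / ((r : ℂ) + 1) else (1 - t.gauss β) / (r - 1) := by
    refine Finset.sum_nbij' (fun b => b⁻¹) (fun b => b⁻¹) ?_ ?_ ?_ ?_ ?_
    · intro b; simp +contextual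
    · intro b; simp +contextual
    · intro b; simp
    · intro b; simp
    · intro b hb
      rw [Finset.mem_erase, mem_E] at hb
      rw [degWeight, t.expSum_of_bar_eq P hE hF hb.2 hb.1,
        t.card_ker_of_bar_eq P hP hE hF hb.2 hb.1]
      have e : 1 + -(P : ℂ) * t.gauss b⁻¹ / P = 1 - t.gauss b⁻¹ := by field_simp; ring
      rw [e]
      split_ifs with h
      · rw [t.gauss_of_isTriv h, hR]
        have : (r : ℂ) ^ 2 - 1 ≠ 0 := by
          have := mul_ne_zero hr1 hr2
          intro h; apply this; linear_combination h
        field_simp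
        ring
      · rw [t.gauss_sq h, hR]
  have htriv0 : t.IsTriv 0 := by intro c _; simp
  have h0E : (0 : F) ∈ t.E := by simp
  rw [h1, Finset.sum_ite, Finset.sum_const, nsmul_eq_mul, ← Finset.sum_div, Finset.sum_sub_distrib,
    Finset.sum_const, nsmul_eq_mul, mul_one]
  have hN : (#{β ∈ t.E | t.IsTriv β} : ℂ) = P / r := by
    rw [eq_div_iff hr0]
    have := t.card_isTriv_mul P hE
    rw [hR] at this
    exact_mod_cast this
  have hN0 : {β ∈ t.E.erase 0 | t.IsTriv β} = {β ∈ t.E | t.IsTriv β}.erase 0 := by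
    ext; simp; tauto
  have hN0' : (#{β ∈ t.E.erase 0 | t.IsTriv β} : ℂ) = P / r - 1 := by
    have h0 : (0 : F) ∈ {β ∈ t.E | t.IsTriv β} := by simp [htriv0]
    rw [hN0, Finset.card_erase_of_mem h0, Nat.cast_sub (Finset.card_pos.2 ⟨_, h0⟩), hN]
    simp
  have hM0 : {β ∈ t.E.erase 0 | ¬ t.IsTriv β} = {β ∈ t.E | ¬ t.IsTriv β} := by
    ext x
    simp only [mem_filter, mem_erase]
    refine ⟨fun h => ⟨h.1.2, h.2⟩, fun h => ⟨⟨fun h' => h.2 (h' ▸ htriv0), h.1⟩, h.2⟩⟩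
  have hM : (#{β ∈ t.E | ¬ t.IsTriv β} : ℂ) = P - P / r := by
    have := Finset.card_filter_add_card_filter_not (s := t.E) t.IsTriv
    rw [hE] at this
    rw [← hN, eq_sub_iff_add_eq']
    exact_mod_cast this
  have hG : ∑ β ∈ t.E with ¬ t.IsTriv β, t.gauss β = 0 := by
    have h := Finset.sum_filter_add_sum_filter_not t.E t.IsTriv t.gauss
    rw [t.sum_gauss P hE, Finset.sum_congr rfl
      (fun β hβ => t.gauss_of_isTriv (mem_filter.1 hβ).2), Finset.sum_const, nsmul_eq_mul, hR, hN,
      div_mul_cancel₀ _ hr0] at h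
    simpa using h
  rw [hN0', hM0, hM, hG]
  field_simp
  ring

/-- The number of nondegenerate parameters whose exponential sum is positive. -/
noncomputable def plusCount (P : ℕ) : ℕ :=
  #{w ∈ t.params | t.expSum w.1 w.2 0 = P}

lemma card_ker_eq_one_of_expSum_eq (P : ℕ) (hP : P ≠ 0) (hF : Fintype.card F = P ^ 2) {w : F × F}
    (hw : w ∈ t.params) (h : t.expSum w.1 w.2 0 = P) : #(t.ker w.1 w.2) = 1 := by
  have h1 := t.expSum_sq (t.mem_params.1 hw).2 w.2
  rw [h, hF] at h1
  have hP' : (P : ℂ) ^ 2 ≠ 0 := by simp [hP]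
  push_cast at h1
  have := mul_left_cancel₀ hP' ((mul_one _).trans h1)
  exact_mod_cast this.symm

lemma card_params (P : ℕ) (hE : #t.E = P) (hF : Fintype.card F = P ^ 2) :
    (#t.params : ℂ) = P ^ 3 - 1 := by
  rw [params, Finset.card_erase_of_mem (by simp), Finset.card_product, Finset.card_univ, hE, hF,
    Nat.cast_sub]
  · push_cast; ring
  · have : 0 < P := by
      rw [← hE]; exact Finset.card_pos.2 ⟨0, by simp⟩
    exact Nat.mul_pos this (by positivity)

lemma plusCount_eq (P r : ℕ) (hr : 2 ≤ r) (hE : #t.E = P) (hR : #t.R = r)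
    (hF : Fintype.card F = P ^ 2) :
    2 * t.plusCount P * (r + 1) = (P ^ 2 - 1) * r * (P + 1) := by
  have hP : P ≠ 0 := by
    rw [← hE]; exact (Finset.card_pos.2 ⟨0, by simp⟩).ne'
  have hP' : (P : ℂ) ≠ 0 := by simp [hP]
  have hr0 : (r : ℂ) ≠ 0 := by simp; omega
  have hr2 : (r : ℂ) + 1 ≠ 0 := by exact_mod_cast (by omega : r + 1 ≠ 0)
  have htot : ∑ w ∈ t.params, (1 + t.expSum w.1 w.2 0 / P) = P ^ 3 - 1 + P ^ 2 - P := by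
    rw [Finset.sum_add_distrib, Finset.sum_const, nsmul_eq_mul, mul_one, t.card_params P hE hF,
      ← Finset.sum_div, t.sum_expSum_params P hE hF]
    field_simp
    ring
  have hsplit := Finset.sum_filter_add_sum_filter_not t.params (fun w => #(t.ker w.1 w.2) ≠ 1)
    (fun w => 1 + t.expSum w.1 w.2 0 / P)
  rw [htot, t.sum_degenerate_eq, t.sum_degWeight P r hr hP hE hR hF, hF] at hsplit
  have hnd : ∑ w ∈ t.params with ¬ #(t.ker w.1 w.2) ≠ 1, (1 + t.expSum w.1 w.2 0 / P) =
      2 * t.plusCount P := by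
    rw [plusCount, Finset.card_filter, Nat.cast_sum, Finset.mul_sum, Finset.sum_filter]
    refine Finset.sum_congr rfl fun w hw => ?_
    by_cases h : t.expSum w.1 w.2 0 = P
    · rw [if_pos h, if_pos (not_not.2 (t.card_ker_eq_one_of_expSum_eq P hP hF hw h)), h,
        div_self hP']
      norm_num
    · rw [if_neg h]
      split_ifs with h1
      · norm_num
      · rw [not_not] at h1
        have h2 := t.expSum_sq (t.mem_params.1 hw).2 w.2
        rw [h1, hF] at h2
        push_cast at h2
        rw [mul_one, sq_eq_sq_iff_eq_or_eq_neg] at h2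
        rw [h2.resolve_left h, neg_div, div_self hP']
        norm_num
  rw [hnd] at hsplit
  have : (2 * t.plusCount P * (r + 1) : ℂ) = (P ^ 2 - 1) * r * (P + 1) := by
    push_cast at hsplit
    field_simp at hsplit
    refine mul_left_cancel₀ hr0 ?_
    linear_combination hsplit
  have hle : 1 ≤ P ^ 2 := Nat.one_le_pow _ _ (Nat.pos_of_ne_zero hP)
  zify [hle]
  exact_mod_cast this

end Twist

/-- A twist over the prime field of `p` elements whose additive character is induced by a linear
form, and for which every nonzero element of the prime field has a square root fixed by `bar` and
`L`. -/
structure LinearTwist (p : ℕ) [Fact p.Prime] (F : Type) [Field F] [Algebra (ZMod p) F] extends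
    Twist F where
  τ : F →ₗ[ZMod p] ZMod p
  χ_eq : ∀ x, χ x = ZMod.stdAddChar (τ x)
  exists_sq : ∀ y : ZMod p, y ≠ 0 → ∃ u, bar u = u ∧ L u = u ∧ u * u = algebraMap (ZMod p) F y

namespace LinearTwist

variable {p : ℕ} [Fact p.Prime] {F : Type} [Field F] [Algebra (ZMod p) F] (t : LinearTwist p F)

lemma bar_algebraMap (y : ZMod p) : t.bar (algebraMap (ZMod p) F y) = algebraMap (ZMod p) F y := by
  by_cases hy : y = 0
  · simp [hy]
  · obtain ⟨u, h1, -, h3⟩ := t.exists_sq y hy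
    rw [← h3, map_mul, h1]

lemma L_algebraMap (y : ZMod p) : t.L (algebraMap (ZMod p) F y) = algebraMap (ZMod p) F y := by
  by_cases hy : y = 0
  · simp [hy]
  · obtain ⟨u, -, h2, h3⟩ := t.exists_sq y hy
    rw [← h3, map_mul, h2]

lemma bar_smul (y : ZMod p) (x : F) : t.bar (y • x) = y • t.bar x := by
  rw [Algebra.smul_def, Algebra.smul_def, map_mul, bar_algebraMap]

lemma L_symm_smul (y : ZMod p) (x : F) : t.L.symm (y • x) = y • t.L.symm x := by
  rw [RingEquiv.symm_apply_eq, Algebra.smul_def, Algebra.smul_def, map_mul, L_algebraMap,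
    RingEquiv.apply_symm_apply]

lemma quad_smul (y : ZMod p) (a b x : F) : t.quad (y • a) (y • b) x = y • t.quad a b x := by
  simp only [Twist.quad, Algebra.smul_def]; ring

lemma polar_smul (y : ZMod p) (a b x : F) : t.polar (y • a) (y • b) x = y • t.polar a b x := by
  simp only [Twist.polar, smul_mul_assoc, L_symm_smul, smul_add]

lemma τ_eq {x y : F} (h : t.χ x = t.χ y) : t.τ x = t.τ y := by
  rw [χ_eq, χ_eq] at h
  exact ZMod.injective_stdAddChar h

/-- The word with parameters `v = (a, b, c, h)`. -/
def word (v : F × F × F × ZMod p) (x : F) : ZMod p :=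
  t.τ (t.quad v.1 v.2.1 x + v.2.2.1 * x) + v.2.2.2

lemma word_smul (y : ZMod p) (v : F × F × F × ZMod p) (x : F) :
    t.word (y • v) x = y * t.word v x := by
  simp only [word, Prod.smul_fst, Prod.smul_snd, quad_smul, smul_mul_assoc]
  rw [← smul_add, map_smul, smul_eq_mul, smul_eq_mul, mul_add]

lemma word_sub (v w : F × F × F × ZMod p) (x : F) :
    t.word (v - w) x = t.word v x - t.word w x := by
  have : t.quad (v - w).1 (v - w).2.1 x + (v - w).2.2.1 * x =
      (t.quad v.1 v.2.1 x + v.2.2.1 * x) - (t.quad w.1 w.2.1 x + w.2.2.1 * x) := by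
    simp only [Twist.quad, Prod.fst_sub, Prod.snd_sub]; ring
  rw [word, this, map_sub, word, word]
  simp only [Prod.snd_sub]
  ring

/-- Precomposing a word with the affine map `x ↦ u * x + e` gives a word. -/
lemma word_affine {v : F × F × F × ZMod p} (hv : t.bar v.1 = v.1) (u e x : F) :
    t.word (v.1 * (u * t.bar u), v.2.1 * (u * t.L u),
      u * (t.polar v.1 v.2.1 e + v.2.2.1), t.word v e) x = t.word v (u * x + e) := by
  have h : t.τ (t.quad v.1 v.2.1 (u * x + e)) =
      t.τ (t.quad v.1 v.2.1 (u * x)) + t.τ (t.quad v.1 v.2.1 e) +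
        t.τ (t.polar v.1 v.2.1 e * (u * x)) := by
    rw [← map_add, ← map_add]
    apply t.τ_eq
    rw [AddChar.map_add_eq_mul, AddChar.map_add_eq_mul]
    exact t.χ_quad_add hv _ _ _
  have e1 : t.quad (v.1 * (u * t.bar u)) (v.2.1 * (u * t.L u)) x = t.quad v.1 v.2.1 (u * x) := by
    simp only [Twist.quad, map_mul]; ring
  have e2 : u * (t.polar v.1 v.2.1 e + v.2.2.1) * x =
      t.polar v.1 v.2.1 e * (u * x) + v.2.2.1 * (u * x) := by ring
  have e3 : v.2.2.1 * (u * x + e) = v.2.2.1 * (u * x) + v.2.2.1 * e := by ring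
  simp only [word, e1, e2, e3, map_add, h]
  ring

variable [Fintype F] [DecidableEq F]

lemma expSum_zmod_smul {y : ZMod p} (hy : y ≠ 0) (a b : F) :
    t.expSum (y • a) (y • b) 0 = t.expSum a b 0 := by
  obtain ⟨u, h1, h2, h3⟩ := t.exists_sq y hy
  have hu : u ≠ 0 := by
    rintro rfl
    apply hy
    apply (algebraMap (ZMod p) F).injective
    rw [← h3, map_zero, zero_mul]
  rw [Algebra.smul_def, Algebra.smul_def, ← h3]
  simpa using t.expSum_smul h1 h2 hu a b 0

lemma card_zeros (v : F × F × F × ZMod p) :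
    (p * #{x | t.word v x = 0} : ℂ) = Fintype.card F + ∑ y ∈ (univ : Finset (ZMod p)).erase 0,
      t.expSum (y • v.1) (y • v.2.1) (y • v.2.2.1) * ZMod.stdAddChar (y * v.2.2.2) := by
  have h1 : (p * #{x | t.word v x = 0} : ℂ) =
      ∑ x, ∑ y : ZMod p, ZMod.stdAddChar (y * t.word v x) := by
    have : ∀ x, ∑ y : ZMod p, ZMod.stdAddChar (y * t.word v x) =
        if t.word v x = 0 then (p : ℂ) else 0 := by
      intro x
      rw [AddChar.sum_mulShift _ (ZMod.isPrimitive_stdAddChar p), ZMod.card]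
      split_ifs <;> simp
    rw [Finset.sum_congr rfl fun x _ => this x, ← Finset.sum_filter, Finset.sum_const,
      nsmul_eq_mul, mul_comm]
  rw [h1, Finset.sum_comm, ← Finset.add_sum_erase _ _ (mem_univ (0 : ZMod p))]
  congr 1
  · simp
  · refine Finset.sum_congr rfl fun y _ => ?_
    rw [Twist.expSum, Finset.sum_mul]
    refine Finset.sum_congr rfl fun x _ => ?_
    rw [← t.word_smul, word, AddChar.map_add_eq_mul, χ_eq]
    rfl

lemma card_zeros_of_notMem {v : F × F × F × ZMod p} (hv : t.bar v.1 = v.1)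
    (hc : ∀ x, t.polar v.1 v.2.1 x ≠ v.2.2.1) :
    p * #{x | t.word v x = 0} = Fintype.card F := by
  have h := t.card_zeros v
  rw [Finset.sum_eq_zero, add_zero] at h
  · exact_mod_cast h
  intro y hy
  have hy0 := Finset.ne_of_mem_erase hy
  rw [t.expSum_eq_zero (by rw [bar_smul, hv]), zero_mul]
  intro hm
  obtain ⟨x, -, hx⟩ := Finset.mem_image.1 hm
  rw [polar_smul] at hx
  exact hc x (smul_right_injective F hy0 hx)

lemma card_zeros_of_polar_eq {v : F × F × F × ZMod p} (hv : t.bar v.1 = v.1) {x : F}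
    (hx : t.polar v.1 v.2.1 x = v.2.2.1) :
    (p * #{x | t.word v x = 0} : ℂ) = Fintype.card F +
      t.expSum v.1 v.2.1 0 * if v.2.2.2 = t.τ (t.quad v.1 v.2.1 x) then (p : ℂ) - 1 else -1 := by
  rw [t.card_zeros v]
  congr 1
  have h : ∀ y ∈ (univ : Finset (ZMod p)).erase 0,
      t.expSum (y • v.1) (y • v.2.1) (y • v.2.2.1) * ZMod.stdAddChar (y * v.2.2.2) =
        t.expSum v.1 v.2.1 0 *
          ZMod.stdAddChar (y * (v.2.2.2 - t.τ (t.quad v.1 v.2.1 x))) := by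
    intro y hy
    rw [← hx, ← polar_smul, t.expSum_polar (by rw [bar_smul, hv]),
      t.expSum_zmod_smul (Finset.ne_of_mem_erase hy), χ_eq, mul_assoc,
      ← AddChar.map_add_eq_mul, map_neg, quad_smul, map_smul, smul_eq_mul]
    congr 2
    ring
  rw [Finset.sum_congr rfl h, ← Finset.mul_sum]
  congr 1
  have h2 := Finset.add_sum_erase univ
    (fun y : ZMod p => (ZMod.stdAddChar (y * (v.2.2.2 - t.τ (t.quad v.1 v.2.1 x))) : ℂ))
    (mem_univ 0)
  rw [AddChar.sum_mulShift _ (ZMod.isPrimitive_stdAddChar p), ZMod.card, zero_mul,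
    AddChar.map_zero_eq_one] at h2
  simp only [sub_eq_zero] at h2
  split_ifs at h2 ⊢ with h3
  · linear_combination h2
  · push_cast at h2
    linear_combination h2

/-- The exponential sum is a real number of absolute value `P * √#ker`. -/
lemma exists_expSum_eq {P : ℕ} (hF : Fintype.card F = P ^ 2) {a : F} (ha : t.bar a = a) (b : F) :
    ∃ ρ : ℝ, t.expSum a b 0 = (P * ρ : ℝ) ∧ ρ ^ 2 = #(t.ker a b) := by
  have h := t.expSum_sq ha b
  have h2 : (Fintype.card F * #(t.ker a b) : ℂ) = ((P * √(#(t.ker a b)) : ℝ) : ℂ) ^ 2 := by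
    rw [← Complex.ofReal_pow, mul_pow, Real.sq_sqrt (Nat.cast_nonneg _), hF]
    push_cast
    rfl
  rw [h2, sq_eq_sq_iff_eq_or_eq_neg] at h
  rcases h with h | h
  · exact ⟨_, h, Real.sq_sqrt (Nat.cast_nonneg _)⟩
  · refine ⟨-√(#(t.ker a b)), ?_, ?_⟩
    · rw [h]; push_cast; ring
    · rw [neg_sq, Real.sq_sqrt (Nat.cast_nonneg _)]

/-- The parameters of the words with `(P ^ 2 + P * (p - 1)) / p` zeros. -/
def heavy (P : ℕ) : Finset (F × F × F × ZMod p) :=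
  {v | t.bar v.1 = v.1 ∧ p * #{x | t.word v x = 0} = P ^ 2 + P * (p - 1)}

lemma mem_heavy {P r : ℕ} (hp : p ≠ 2) (hpr : p ∣ r) (hP : 2 ≤ P) (hE : #t.E = P)
    (hR : #t.R = r) (hF : Fintype.card F = P ^ 2) {v : F × F × F × ZMod p} :
    v ∈ t.heavy P ↔ (v.1, v.2.1) ∈ t.params ∧ t.expSum v.1 v.2.1 0 = P ∧
      ∃ x, t.polar v.1 v.2.1 x = v.2.2.1 ∧ v.2.2.2 = t.τ (t.quad v.1 v.2.1 x) := by
  have hp2 : 2 < p := lt_of_le_of_ne (Fact.out : p.Prime).two_le hp.symm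
  have hP0 : (P : ℝ) ≠ 0 := by positivity
  have hp1 : (p : ℝ) - 1 ≠ 0 := by
    have : (2 : ℝ) < p := by exact_mod_cast hp2
    linarith
  simp only [heavy, mem_filter, mem_univ, true_and]
  constructor
  · rintro ⟨hv, h⟩
    obtain ⟨x, hx⟩ : ∃ x, t.polar v.1 v.2.1 x = v.2.2.1 := by
      by_contra! hc
      rw [t.card_zeros_of_notMem hv hc, hF] at h
      have : 0 < P * (p - 1) := Nat.mul_pos (by omega) (by omega)
      omega
    have h1 := t.card_zeros_of_polar_eq hv hx
    obtain ⟨ρ, hρ, hρ2⟩ := t.exists_expSum_eq hF hv v.2.1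
    have h2 : (P : ℝ) * (p - 1) =
        P * ρ * if v.2.2.2 = t.τ (t.quad v.1 v.2.1 x) then (p : ℝ) - 1 else -1 := by
      have h3 : (p * #{x | t.word v x = 0} : ℂ) = P ^ 2 + P * (p - 1) := by
        have : ((p - 1 : ℕ) : ℂ) = p - 1 := by push_cast [Nat.cast_sub (by omega : 1 ≤ p)]; ring
        rw [← this]
        exact_mod_cast h
      rw [h3, hρ, hF] at h1
      push_cast at h1
      apply Complex.ofReal_injective
      push_cast [apply_ite Complex.ofReal]
      linear_combination h1
    have hcases : (ρ = 1 ∧ v.2.2.2 = t.τ (t.quad v.1 v.2.1 x)) ∨ ρ = -(p - 1) := by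
      split_ifs at h2 with h3
      · left
        refine ⟨?_, h3⟩
        apply mul_left_cancel₀ (mul_ne_zero hP0 hp1)
        linear_combination -h2
      · right
        apply mul_left_cancel₀ hP0
        linear_combination h2
    have hpar : (v.1, v.2.1) ∈ t.params := by
      rw [Twist.mem_params]
      refine ⟨fun h0 => ?_, hv⟩
      have h01 : v.1 = 0 := (Prod.ext_iff.1 h0).1
      have h02 : v.2.1 = 0 := (Prod.ext_iff.1 h0).2
      have hz : t.expSum v.1 v.2.1 0 = ((P * P : ℝ) : ℂ) := by
        simp [h01, h02, Twist.expSum, Twist.quad, hF, sq]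
      rw [hz] at hρ
      have := mul_left_cancel₀ hP0 (Complex.ofReal_injective hρ)
      have hPr : (2 : ℝ) ≤ P := by exact_mod_cast hP
      have hpr : (2 : ℝ) < p := by exact_mod_cast hp2
      rcases hcases with ⟨h, -⟩ | h <;> linarith
    rcases hcases with ⟨h3, h4⟩ | h3
    · exact ⟨hpar, by rw [hρ, h3]; simp, x, hx, h4⟩
    · exfalso
      rw [h3] at hρ2
      have h5 : (p - 1) ^ 2 = #(t.ker v.1 v.2.1) := by
        have : ((p - 1 : ℕ) : ℝ) = p - 1 := by push_cast [Nat.cast_sub (by omega : 1 ≤ p)]; ring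
        rw [neg_sq, ← this] at hρ2
        exact_mod_cast hρ2
      have hnd : ¬ p ∣ (p - 1) ^ 2 := by
        intro hd
        have := Nat.le_of_dvd (by omega) ((Fact.out : p.Prime).dvd_of_dvd_pow hd)
        omega
      rcases t.card_ker_eq_or P r hE hR hF hpar with hk | hk | hk <;> simp only at hk
      · rw [hk] at h5
        have : 2 ≤ p - 1 := by omega
        nlinarith
      · exact hnd (by rw [h5, hk]; exact hpr)
      · exact hnd (by rw [h5, hk]; exact hpr.trans (dvd_pow_self r two_ne_zero))
  · rintro ⟨h1, h2, x, hx, hh⟩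
    have hv := (t.mem_params.1 h1).2
    refine ⟨hv, ?_⟩
    have h3 := t.card_zeros_of_polar_eq hv hx
    rw [if_pos hh, h2, hF] at h3
    have : ((p - 1 : ℕ) : ℂ) = p - 1 := by push_cast [Nat.cast_sub (by omega : 1 ≤ p)]; ring
    rw [← this] at h3
    exact_mod_cast h3

lemma card_heavy {P r : ℕ} (hp : p ≠ 2) (hpr : p ∣ r) (hP : 2 ≤ P) (hE : #t.E = P)
    (hR : #t.R = r) (hF : Fintype.card F = P ^ 2) :
    #(t.heavy P) = t.plusCount P * P ^ 2 := by
  rw [Twist.plusCount, ← hF, ← Finset.card_univ, ← Finset.card_product, eq_comm]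
  have key := fun v => t.mem_heavy hp hpr hP hE hR hF (v := v)
  refine Finset.card_bij (fun w _ =>
    (w.1.1, w.1.2, t.polar w.1.1 w.1.2 w.2, t.τ (t.quad w.1.1 w.1.2 w.2))) ?_ ?_ ?_
  · rintro ⟨w, x⟩ hw
    simp only [Finset.mem_product, mem_filter, mem_univ, and_true] at hw
    exact (key _).2 ⟨hw.1, hw.2, x, rfl, rfl⟩
  · rintro ⟨⟨a, b⟩, x⟩ hw ⟨⟨a', b'⟩, x'⟩ hw' h
    simp only [Prod.mk.injEq] at h
    obtain ⟨rfl, rfl, h, -⟩ := h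
    simp only [Finset.mem_product, mem_filter, mem_univ, and_true] at hw
    have h1 := t.card_ker_eq_one_of_expSum_eq P (by omega) hF hw.1 hw.2
    have h2 : x - x' ∈ t.ker a b := by
      rw [Twist.mem_ker, sub_eq_add_neg, t.polar_add, t.polar_neg, h, add_neg_cancel]
    have h3 := Finset.card_le_one.1 h1.le _ h2 _ (t.zero_mem_ker a b)
    rw [sub_eq_zero.1 h3]
  · rintro ⟨a, b, c, h⟩ hv
    obtain ⟨h1, h2, x, h3, h4⟩ := (key _).1 hv
    refine ⟨((a, b), x), by simpa using ⟨h1, h2⟩, ?_⟩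
    simp only at h3 h4
    rw [h3, h4]

lemma card_zeros_le {P r : ℕ} (hr : 1 ≤ r) (hE : #t.E = P)
    (hR : #t.R = r) (hF : Fintype.card F = P ^ 2) {v : F × F × F × ZMod p}
    (hv : t.bar v.1 = v.1) (hv0 : v ≠ 0) :
    p * #{x | t.word v x = 0} ≤ P ^ 2 + (p - 1) * (P * r) := by
  have hp2 : 2 ≤ p := (Fact.out : p.Prime).two_le
  by_cases hc : ∃ x, t.polar v.1 v.2.1 x = v.2.2.1
  swap
  · push Not at hc
    rw [t.card_zeros_of_notMem hv hc, hF]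
    exact Nat.le_add_right _ _
  obtain ⟨x, hx⟩ := hc
  have h1 := t.card_zeros_of_polar_eq hv hx
  obtain ⟨ρ, hρ, hρ2⟩ := t.exists_expSum_eq hF hv v.2.1
  by_cases hpar : (v.1, v.2.1) ∈ t.params
  · have hρr : |ρ| ≤ r := by
      apply abs_le_of_sq_le_sq _ (Nat.cast_nonneg _)
      rw [hρ2]
      have hr2 : r ≤ r ^ 2 := Nat.le_self_pow two_ne_zero r
      have := t.card_ker_eq_or P r hE hR hF hpar
      simp only at this
      exact_mod_cast (by omega : #(t.ker v.1 v.2.1) ≤ r ^ 2)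
    rw [abs_le] at hρr
    have hpR : (2 : ℝ) ≤ p := by exact_mod_cast hp2
    have h2 : (p * #{x | t.word v x = 0} : ℝ) = P ^ 2 + P * ρ *
        if v.2.2.2 = t.τ (t.quad v.1 v.2.1 x) then (p : ℝ) - 1 else -1 := by
      rw [hρ, hF] at h1
      apply Complex.ofReal_injective
      push_cast [apply_ite Complex.ofReal]
      push_cast at h1
      exact h1
    have h3 : (p * #{x | t.word v x = 0} : ℝ) ≤ P ^ 2 + (p - 1) * (P * r) := by
      rw [h2]
      have hPR : (0 : ℝ) ≤ P := Nat.cast_nonneg _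
      have h4 : P * ρ ≤ P * r := mul_le_mul_of_nonneg_left hρr.2 hPR
      have h5 : -(P * ρ) ≤ P * r := by nlinarith
      have h6 : (0 : ℝ) ≤ P * r := by positivity
      split_ifs
      · nlinarith
      · nlinarith
    have : ((p - 1 : ℕ) : ℝ) = p - 1 := by push_cast [Nat.cast_sub (by omega : 1 ≤ p)]; ring
    rw [← this] at h3
    exact_mod_cast h3
  · have h0 : (v.1, v.2.1) = 0 := by
      by_contra h
      exact hpar (t.mem_params.2 ⟨h, hv⟩)
    have h01 : v.1 = 0 := (Prod.ext_iff.1 h0).1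
    have h02 : v.2.1 = 0 := (Prod.ext_iff.1 h0).2
    have h03 : v.2.2.1 = 0 := by
      rw [← hx, h01, h02]; simp [Twist.polar]
    have h04 : v.2.2.2 ≠ 0 := fun h => hv0 (Prod.ext h01 (Prod.ext h02 (Prod.ext h03 h)))
    have : #{x | t.word v x = 0} = 0 := by
      rw [Finset.card_eq_zero, Finset.filter_eq_empty_iff]
      intro x _
      simp [word, Twist.quad, h01, h02, h03, h04]
    rw [this]
    simp

/-- The support of a word. -/
def supp (v : F × F × F × ZMod p) : Finset F := {x | t.word v x ≠ 0}

@[simp] lemma mem_supp {v : F × F × F × ZMod p} {x : F} : x ∈ t.supp v ↔ t.word v x ≠ 0 := by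
  simp [supp]

lemma card_supp_add_card_zeros (v : F × F × F × ZMod p) :
    #(t.supp v) + #{x | t.word v x = 0} = Fintype.card F := by
  rw [add_comm, supp]
  exact Finset.card_filter_add_card_filter_not (s := univ) (fun x => t.word v x = 0)

lemma supp_smul {y : ZMod p} (hy : y ≠ 0) (v : F × F × F × ZMod p) :
    t.supp (y • v) = t.supp v := by
  ext x
  simp [word_smul, hy]

lemma smul_mem_heavy {P : ℕ} {y : ZMod p} (hy : y ≠ 0) {v : F × F × F × ZMod p}
    (hv : v ∈ t.heavy P) : y • v ∈ t.heavy P := by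
  simp only [heavy, mem_filter, mem_univ, true_and, word_smul, mul_eq_zero, hy, false_or] at hv ⊢
  refine ⟨?_, hv.2⟩
  rw [Prod.smul_fst, bar_smul, hv.1]

lemma exists_smul_eq_of_supp_eq {P r : ℕ} (hr : 1 ≤ r) (hPr : p * r ≤ P) (hE : #t.E = P)
    (hR : #t.R = r) (hF : Fintype.card F = P ^ 2) {v w : F × F × F × ZMod p}
    (hv : v ∈ t.heavy P) (hw : w ∈ t.heavy P) (h : t.supp v = t.supp w) :
    ∃ y : ZMod p, y ≠ 0 ∧ y • v = w := by
  have hp2 : 2 ≤ p := (Fact.out : p.Prime).two_le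
  by_contra! hne
  simp only [heavy, mem_filter, mem_univ, true_and] at hv hw
  have h1 : ∑ y ∈ (univ : Finset (ZMod p)).erase 0, p * #{x | t.word (w - y • v) x = 0} ≤
      (p - 1) * (P ^ 2 + (p - 1) * (P * r)) := by
    refine (Finset.sum_le_card_nsmul _ _ (P ^ 2 + (p - 1) * (P * r)) fun y hy => ?_).trans_eq ?_
    · refine t.card_zeros_le hr hE hR hF ?_ ?_
      · rw [Prod.fst_sub, Prod.smul_fst, map_sub, bar_smul, hv.1, hw.1]
      · rw [sub_ne_zero]
        exact (hne y (Finset.ne_of_mem_erase hy)).symm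
    · rw [Finset.card_erase_of_mem (mem_univ _), Finset.card_univ, ZMod.card, smul_eq_mul]
  have h2 : ∑ y ∈ (univ : Finset (ZMod p)).erase 0, #{x | t.word (w - y • v) x = 0} =
      #(t.supp v) + (p - 1) * #{x | t.word v x = 0} := by
    simp only [Finset.card_filter, word_sub, word_smul]
    rw [Finset.sum_comm, supp, Finset.card_filter, Finset.mul_sum, ← Finset.sum_add_distrib]
    refine Finset.sum_congr rfl fun x _ => ?_
    have hx : t.word v x ≠ 0 ↔ t.word w x ≠ 0 := by
      rw [← t.mem_supp, ← t.mem_supp, h]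
    rw [← Finset.card_filter]
    by_cases h0 : t.word v x = 0
    · have h0' : t.word w x = 0 := by
        by_contra hc
        exact hx.2 hc h0
      simp [h0, h0', ZMod.card]
    · have h0' := hx.1 h0
      have : {y ∈ (univ : Finset (ZMod p)).erase 0 | t.word w x - y * t.word v x = 0} =
          {t.word w x / t.word v x} := by
        ext y
        simp only [mem_filter, mem_erase, mem_univ, and_true, mem_singleton, sub_eq_zero,
          eq_div_iff h0]
        refine ⟨fun h => h.2.symm, fun h => ⟨?_, h.symm⟩⟩
        rintro rfl
        rw [zero_mul] at h
        exact h0' h.symm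
      rw [this]
      simp [h0]
  rw [← Finset.mul_sum, h2] at h1
  have h3 := t.card_supp_add_card_zeros v
  have h4 := hv.2
  rw [hF] at h3
  have hP : 0 < P := lt_of_lt_of_le (Nat.mul_pos (by omega) hr) hPr
  obtain ⟨k, rfl⟩ := Nat.exists_eq_add_of_le' hp2
  simp only [show k + 2 - 1 = k + 1 by omega] at h1 h4
  generalize #{x | t.word v x = 0} = z at *
  generalize #(t.supp v) = i at *
  have h5 : (k + 2) * (i + (k + 1) * z) = (k + 2) * P ^ 2 + k * (P ^ 2 + P * (k + 1)) := by
    linear_combination (k + 2) * h3 + k * h4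
  rw [h5] at h1
  have h6 : P * (P + k) ≤ P * ((k + 1) * r) := by
    have : (k + 1) * (P * (P + k)) ≤ (k + 1) * (P * ((k + 1) * r)) := by nlinarith
    exact le_of_mul_le_mul_left this (by omega)
  have h7 := le_of_mul_le_mul_left h6 hP
  nlinarith

/-- The distinct supports of the heavy words. -/
def blocks (P : ℕ) : Finset (Finset F) := (t.heavy P).image t.supp

lemma card_blocks {P r : ℕ} (hr : 1 ≤ r) (hPr : p * r ≤ P) (hE : #t.E = P)
    (hR : #t.R = r) (hF : Fintype.card F = P ^ 2) :
    #(t.heavy P) = #(t.blocks P) * (p - 1) := by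
  have hp2 : 2 ≤ p := (Fact.out : p.Prime).two_le
  rw [Finset.card_eq_sum_card_image t.supp, ← blocks, Finset.sum_const_nat]
  intro S hS
  obtain ⟨v, hv, rfl⟩ := Finset.mem_image.1 hS
  have hv0 : v ≠ 0 := by
    rintro rfl
    have hw : ∀ x, t.word 0 x = 0 := by simp [word, Twist.quad]
    simp only [heavy, mem_filter, mem_univ, true_and, hw, Finset.filter_true, Finset.card_univ,
      hF] at hv
    have h2 : 2 ≤ P := hp2.trans ((Nat.le_mul_of_pos_right p hr).trans hPr)
    obtain ⟨k, rfl⟩ := Nat.exists_eq_add_of_le' hp2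
    have h3 := hv.2
    rw [show k + 2 - 1 = k + 1 by omega] at h3
    nlinarith [Nat.mul_le_mul_left ((k + 1) * P) h2]
  have : {w ∈ t.heavy P | t.supp w = t.supp v} =
      ((univ : Finset (ZMod p)).erase 0).image (fun y => y • v) := by
    ext w
    simp only [mem_filter, mem_image, mem_erase, mem_univ, and_true]
    constructor
    · rintro ⟨h1, h2⟩
      exact t.exists_smul_eq_of_supp_eq hr hPr hE hR hF hv h1 h2.symm
    · rintro ⟨y, hy, rfl⟩
      exact ⟨t.smul_mem_heavy hy hv, t.supp_smul hy v⟩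
  rw [this, Finset.card_image_of_injective _ (smul_left_injective (ZMod p) hv0),
    Finset.card_erase_of_mem (mem_univ _), Finset.card_univ, ZMod.card]

lemma affine_mem_blocks {P : ℕ} {S : Finset F} (hS : S ∈ t.blocks P) {u : F} (hu : u ≠ 0) (e : F) :
    ({x | u * x + e ∈ S} : Finset F) ∈ t.blocks P := by
  obtain ⟨v, hv, rfl⟩ := Finset.mem_image.1 hS
  simp only [heavy, mem_filter, mem_univ, true_and] at hv
  refine Finset.mem_image.2 ⟨(v.1 * (u * t.bar u), v.2.1 * (u * t.L u),
      u * (t.polar v.1 v.2.1 e + v.2.2.1), t.word v e), ?_, ?_⟩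
  · simp only [heavy, mem_filter, mem_univ, true_and, map_mul, t.bar_bar, hv.1,
      t.word_affine hv.1]
    refine ⟨by ring, ?_⟩
    rw [← hv.2]
    congr 1
    refine Finset.card_equiv ((Equiv.mulLeft₀ u hu).trans (Equiv.addRight e)) fun x => ?_
    simp
  · ext x
    simp [t.word_affine hv.1]

lemma card_blocks_affine_le (P : ℕ) {u : F} (hu : u ≠ 0) (e x y : F) :
    #{S ∈ t.blocks P | u * x + e ∈ S ∧ u * y + e ∈ S} ≤ #{S ∈ t.blocks P | x ∈ S ∧ y ∈ S} := by
  refine Finset.card_le_card_of_injOn (fun S => univ.filter fun x => u * x + e ∈ S) ?_ ?_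
  · intro S hS
    simp only [coe_filter, Set.mem_ofPred_eq] at hS ⊢
    exact ⟨t.affine_mem_blocks hS.1 hu e, by simpa using hS.2⟩
  · intro S _ S' _ h
    ext z
    have := Finset.ext_iff.1 h ((z - e) / u)
    simpa [mul_div_cancel₀ _ hu] using this

lemma card_blocks_pair (P : ℕ) {x y : F} (hxy : x ≠ y) :
    #{S ∈ t.blocks P | x ∈ S ∧ y ∈ S} = #{S ∈ t.blocks P | 0 ∈ S ∧ 1 ∈ S} := by
  have hu : y - x ≠ 0 := sub_ne_zero.2 hxy.symm
  refine le_antisymm ?_ ?_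
  · have := t.card_blocks_affine_le P hu x 0 1
    simpa using this
  · have := t.card_blocks_affine_le P (inv_ne_zero hu) (-((y - x)⁻¹ * x)) x y
    rwa [add_neg_cancel, ← sub_eq_add_neg, ← mul_sub, inv_mul_cancel₀ hu] at this

lemma card_blocks_mul (P i : ℕ) (hi : ∀ S ∈ t.blocks P, #S = i) {x y : F} (hxy : x ≠ y) :
    #{S ∈ t.blocks P | x ∈ S ∧ y ∈ S} * (Fintype.card F * (Fintype.card F - 1)) =
      #(t.blocks P) * (i * (i - 1)) := by
  have h1 : ∑ z ∈ (univ : Finset F).offDiag, #{S ∈ t.blocks P | z.1 ∈ S ∧ z.2 ∈ S} =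
      (Fintype.card F * (Fintype.card F - 1)) * #{S ∈ t.blocks P | x ∈ S ∧ y ∈ S} := by
    rw [Finset.sum_congr rfl fun z hz =>
      (t.card_blocks_pair P (Finset.mem_offDiag.1 hz).2.2).trans (t.card_blocks_pair P hxy).symm,
      Finset.sum_const, Finset.offDiag_card, Finset.card_univ, smul_eq_mul, Nat.mul_sub_one]
  have h2 : ∑ z ∈ (univ : Finset F).offDiag, #{S ∈ t.blocks P | z.1 ∈ S ∧ z.2 ∈ S} =
      ∑ S ∈ t.blocks P, #S.offDiag := by
    refine (Finset.sum_card_bipartiteAbove_eq_sum_card_bipartiteBelow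
      (fun (z : F × F) (S : Finset F) => z.1 ∈ S ∧ z.2 ∈ S)).trans ?_
    refine Finset.sum_congr rfl fun S _ => ?_
    congr 1
    ext z
    simp only [bipartiteBelow, mem_filter, mem_offDiag, mem_univ, true_and]
    tauto
  rw [mul_comm, ← h1, h2, Finset.sum_congr rfl fun S hS => by
    rw [Finset.offDiag_card, hi S hS], Finset.sum_const, smul_eq_mul, Nat.mul_sub_one]

lemma mem_heavy_iff_card_supp {Q : ℕ} (hQ : 1 ≤ Q) (hF : Fintype.card F = (p * Q) ^ 2)
    {v : F × F × F × ZMod p} :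
    v ∈ t.heavy (p * Q) ↔ t.bar v.1 = v.1 ∧ #(t.supp v) = Q * (p - 1) * (p * Q - 1) := by
  have hp2 : 2 ≤ p := (Fact.out : p.Prime).two_le
  have hPQ : 1 ≤ p * Q := Nat.mul_pos (by omega) hQ
  have h1 := t.card_supp_add_card_zeros v
  rw [hF] at h1
  simp only [heavy, mem_filter, mem_univ, true_and]
  refine and_congr_right fun _ => ?_
  generalize #{x | t.word v x = 0} = z at *
  generalize #(t.supp v) = i at *
  zify [hPQ, (by omega : 1 ≤ p)] at h1 ⊢
  have hp0 : (p : ℤ) ≠ 0 := by positivity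
  constructor
  · intro h
    refine mul_left_cancel₀ hp0 ?_
    linear_combination p * h1 - h
  · intro h
    linear_combination p * h1 - p * h

lemma card_blocks_pair_eq {Q r : ℕ} (hp : p ≠ 2) (hpr : p ∣ r) (hr : 1 ≤ r) (hPr : r ≤ Q)
    (hE : #t.E = p * Q) (hR : #t.R = r) (hF : Fintype.card F = (p * Q) ^ 2) {x y : F}
    (hxy : x ≠ y) :
    (#{S ∈ t.blocks (p * Q) | x ∈ S ∧ y ∈ S} : ℚ) =
      r * Q * (Q * (p - 1) * (p * Q - 1) - 1) * ((p * Q) ^ 2 - 1) / (2 * (r + 1)) := by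
  have hp2 : 2 ≤ p := (Fact.out : p.Prime).two_le
  have hQ : 1 ≤ Q := hr.trans hPr
  have hPQ : 2 ≤ p * Q := by nlinarith
  have hr2 : 2 ≤ r := hp2.trans (Nat.le_of_dvd hr hpr)
  have hi : ∀ S ∈ t.blocks (p * Q), #S = Q * (p - 1) * (p * Q - 1) := by
    intro S hS
    obtain ⟨v, hv, rfl⟩ := Finset.mem_image.1 hS
    exact ((t.mem_heavy_iff_card_supp hQ hF).1 hv).2
  have h1 := t.card_blocks_mul _ _ hi hxy
  have h2 := t.card_blocks hr (Nat.mul_le_mul_left p hPr) hE hR hF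
  have h3 := t.card_heavy hp hpr hPQ hE hR hF
  have h4 := t.plusCount_eq _ r hr2 hE hR hF
  rw [h3] at h2
  rw [hF] at h1
  generalize #{S ∈ t.blocks (p * Q) | x ∈ S ∧ y ∈ S} = m at *
  generalize #(t.blocks (p * Q)) = B at *
  generalize t.plusCount (p * Q) = A at *
  have hP2 : 1 ≤ (p * Q) ^ 2 := Nat.one_le_pow _ _ (by omega)
  have hi1 : 1 ≤ Q * (p - 1) * (p * Q - 1) :=
    Nat.mul_pos (Nat.mul_pos hQ (by omega)) (by omega)
  have e1 := congrArg (Nat.cast (R := ℚ)) h1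
  have e2 := congrArg (Nat.cast (R := ℚ)) h2
  have e4 := congrArg (Nat.cast (R := ℚ)) h4
  push_cast [Nat.cast_sub hP2, Nat.cast_sub hi1, Nat.cast_sub (by omega : 1 ≤ p),
    Nat.cast_sub (by omega : 1 ≤ p * Q)] at e1 e2 e4
  have hpq : (p : ℚ) - 1 ≠ 0 := by
    have : (2 : ℚ) ≤ p := by exact_mod_cast hp2
    linarith
  have hPQq : (2 : ℚ) ≤ p * Q := by exact_mod_cast hPQ
  have hPm : (p * Q : ℚ) ^ 2 - 1 ≠ 0 := by nlinarith
  have hP0 : (p * Q : ℚ) ^ 2 ≠ 0 := by positivity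
  have hr0 : (2 * (r + 1) : ℚ) ≠ 0 := by positivity
  rw [eq_div_iff hr0]
  refine mul_left_cancel₀ (mul_ne_zero (mul_ne_zero hP0 hPm) hpq) ?_
  generalize hI : (Q * (p - 1) * (p * Q - 1) : ℚ) = I at *
  linear_combination (p - 1) * (2 * (r + 1)) * e1 - I * (I - 1) * (2 * (r + 1)) * e2 +
    (p * Q) ^ 2 * I * (I - 1) * e4 -
      (p * Q) ^ 2 * ((p * Q) ^ 2 - 1) * r * (p * Q + 1) * (I - 1) * hI

end LinearTwist

section FiniteFields

variable {p : ℕ} [Fact p.Prime] {F : Type} [Field F] [CharP F p]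

lemma isPeriodicPt_frobenius {n : ℕ} {x : F} :
    Function.IsPeriodicPt (frobenius F p) n x ↔ x ^ p ^ n = x := by
  rw [Function.IsPeriodicPt, Function.IsFixedPt, iterate_frobenius]

lemma pow_prime_pow_eq_self_of_dvd {m n : ℕ} (h : m ∣ n) {x : F} (hx : x ^ p ^ m = x) :
    x ^ p ^ n = x :=
  isPeriodicPt_frobenius.1 ((isPeriodicPt_frobenius.2 hx).trans_dvd h)

lemma pow_prime_pow_gcd_eq_self {m n : ℕ} {x : F} (hm : x ^ p ^ m = x) (hn : x ^ p ^ n = x) :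
    x ^ p ^ m.gcd n = x :=
  isPeriodicPt_frobenius.1 ((isPeriodicPt_frobenius.2 hm).gcd (isPeriodicPt_frobenius.2 hn))

variable [Fintype F]

lemma pow_card_prime_pow {n : ℕ} (hF : Fintype.card F = p ^ n) (x : F) : x ^ p ^ n = x := by
  rw [← hF, FiniteField.pow_card]

lemma card_filter_pow_prime_pow_eq_self [DecidableEq F] {n k : ℕ}
    (hF : Fintype.card F = p ^ n) (hk : k ∣ n) :
    #{x : F | x ^ p ^ k = x} = p ^ k := by
  have hp : p.Prime := Fact.out
  have hpos : 1 ≤ p ^ k := Nat.one_le_pow _ _ hp.pos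
  have h1 : #{u : Fˣ | u ^ (p ^ k - 1) = 1} = p ^ k - 1 := by
    have := IsCyclic.card_powMonoidHom_ker (G := Fˣ) (p ^ k - 1)
    rw [Nat.card_eq_fintype_card (α := Fˣ), Fintype.card_units, hF,
      Nat.pow_sub_one_gcd_pow_sub_one, Nat.gcd_eq_right hk] at this
    refine Eq.trans ?_ this
    rw [Nat.card_eq_fintype_card, Fintype.card_subtype]
    simp [MonoidHom.mem_ker]
  have h2 : ({x : F | x ^ p ^ k = x} : Finset F) =
      insert 0 (({u : Fˣ | u ^ (p ^ k - 1) = 1} : Finset Fˣ).map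
        ⟨Units.val, Units.val_injective⟩) := by
    ext x
    simp only [mem_filter, mem_univ, true_and, mem_insert, mem_map, Function.Embedding.coeFn_mk]
    constructor
    · intro h
      by_cases hx : x = 0
      · exact Or.inl hx
      · refine Or.inr ⟨Units.mk0 x hx, ?_, rfl⟩
        ext
        refine mul_right_cancel₀ hx ?_
        simp only [Units.val_pow_eq_pow_val, Units.val_mk0, Units.val_one, one_mul]
        rw [← pow_succ, Nat.sub_add_cancel hpos, h]
    · rintro (rfl | ⟨u, hu, rfl⟩)
      · exact zero_pow (by omega)
      · rw [← Nat.sub_add_cancel hpos, pow_succ, ← Units.val_pow_eq_pow_val, hu, Units.val_one,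
          one_mul]
  rw [h2, Finset.card_insert_of_notMem, Finset.card_map, h1, Nat.sub_add_cancel hpos]
  simp

lemma exists_sq_eq_of_pow_eq_one (hodd : Odd p) {n d : ℕ} (hF : Fintype.card F = p ^ n)
    (hn : Even n) (hd : Even d) {y : F} (hy : y ^ (p - 1) = 1) :
    ∃ u, u ^ p ^ d = u ∧ u * u = y := by
  have hp : p.Prime := Fact.out
  have hp2 : p ≠ 2 := by rintro rfl; exact absurd hodd (by decide)
  have hy0 : y ≠ 0 := by
    rintro rfl
    rw [zero_pow (by have := hp.two_le; omega)] at hy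
    exact zero_ne_one hy
  have key : ∀ k, Even k → ∃ j, p ^ k = (p - 1) * j * 2 + 1 := by
    rintro k ⟨e, rfl⟩
    obtain ⟨j, hj⟩ := Nat.sub_one_dvd_pow_sub_one p e
    obtain ⟨i, hi⟩ := hodd.pow (n := e)
    refine ⟨j * (i + 1), ?_⟩
    have h1 : p ^ e = (p - 1) * j + 1 := by
      have := Nat.one_le_pow e p hp.pos
      omega
    calc p ^ (e + e) = p ^ e * p ^ e := pow_add _ _ _
      _ = ((p - 1) * j + 1) * (2 * i + 1) := by rw [← hi, ← h1]
      _ = (p - 1) * j * (2 * i + 1 + 1) + 1 := by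
        have : (p - 1) * j = 2 * i := by omega
        rw [this]; ring
      _ = _ := by ring
  have hone : ∀ j, y ^ ((p - 1) * j) = 1 := fun j => by rw [pow_mul, hy, one_pow]
  obtain ⟨j, hj⟩ := key n hn
  obtain ⟨u, hu⟩ : IsSquare y := by
    rw [FiniteField.isSquare_iff (by rwa [ringChar.eq F p]) hy0, hF, hj,
      show ((p - 1) * j * 2 + 1) / 2 = (p - 1) * j by omega, hone]
  obtain ⟨i, hi⟩ := key d hd
  refine ⟨u, ?_, hu.symm⟩
  rw [hi, pow_succ, mul_comm _ 2, pow_mul, sq, ← hu, hone, one_mul]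

end FiniteFields

section Trace

variable {p : ℕ} [Fact p.Prime] {F : Type} [Field F] [Fintype F] [Algebra (ZMod p) F]

lemma trace_pow_prime_pow (k : ℕ) (x : F) :
    Algebra.trace (ZMod p) F (x ^ p ^ k) = Algebra.trace (ZMod p) F x := by
  induction k with
  | zero => simp
  | succ k ih =>
    have h := Algebra.trace_eq_of_algEquiv
      (FiniteField.frobeniusAlgEquivOfAlgebraic (ZMod p) F) (x ^ p ^ k)
    rw [FiniteField.coe_frobeniusAlgEquivOfAlgebraic, ZMod.card] at h
    rw [← ih, ← h, pow_succ, pow_mul]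

lemma algebraMap_trace_eq_trp {n : ℕ} (hF : Fintype.card F = p ^ n) (x : F) :
    algebraMap (ZMod p) F (Algebra.trace (ZMod p) F x) = trp p n x := by
  have h : Module.finrank (ZMod p) F = n := by
    have := Module.card_eq_pow_finrank (K := ZMod p) (V := F)
    rw [hF, ZMod.card] at this
    exact (Nat.pow_right_injective (Fact.out : p.Prime).two_le this).symm
  rw [FiniteField.algebraMap_trace_eq_sum_pow, h, Nat.card_zmod, trp]

end Trace

lemma trp_add_self {p r : ℕ} [Fact p.Prime] {F : Type} [Field F] {x : F} (hx : x ^ p ^ r = x) :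
    trp p (2 * r) x = 2 * trp p r x := by
  rw [trp, two_mul, Finset.sum_range_add, two_mul, trp]
  congr 1
  refine Finset.sum_congr rfl fun i _ => ?_
  rw [pow_add, pow_mul, hx]

section FrobeniusTwist

variable {p : ℕ} [Fact p.Prime] {F : Type} [Field F] [Fintype F] [Algebra (ZMod p) F]
  [CharP F p]

/-- The twist of `F` given by the Frobenius powers `x ↦ x ^ p ^ s` and `x ↦ x ^ p ^ l`. -/
noncomputable def frobeniusTwist (s l : ℕ) (hodd : Odd p) (hF : Fintype.card F = p ^ (2 * s))
    (hd' : (s + l).gcd (2 * l) = s.gcd l) (hd : Even (s.gcd l)) : LinearTwist p F where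
  bar := iterateFrobeniusEquiv F p s
  L := iterateFrobeniusEquiv F p l
  χ := ZMod.stdAddChar.compAddMonoidHom (Algebra.trace (ZMod p) F).toAddMonoidHom
  bar_bar x := by
    simp only [iterateFrobeniusEquiv_def]
    rw [← pow_mul, ← pow_add, ← two_mul, pow_card_prime_pow hF]
  comm x := by
    simp only [iterateFrobeniusEquiv_def]
    rw [← pow_mul, ← pow_mul, mul_comm]
  χ_bar x := congrArg ZMod.stdAddChar (trace_pow_prime_pow s x)
  χ_L x := congrArg ZMod.stdAddChar (trace_pow_prime_pow l x)
  χ_ne h := by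
    obtain ⟨x, hx⟩ := Algebra.trace_surjective (ZMod p) F 1
    have h1 : ZMod.stdAddChar (Algebra.trace (ZMod p) F x) = (1 : ℂ) := DFunLike.congr_fun h x
    rw [hx, ← AddChar.map_zero_eq_one (ZMod.stdAddChar (N := p))] at h1
    exact one_ne_zero (ZMod.injective_stdAddChar h1)
  two := Ring.two_ne_zero (by
    rw [ringChar.eq F p]; rintro rfl; exact absurd hodd (by decide))
  fix x hx := by
    simp only [iterateFrobeniusEquiv_def] at hx ⊢
    rw [← pow_mul, ← pow_add] at hx
    have h1 := pow_prime_pow_gcd_eq_self hx (pow_card_prime_pow hF x)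
    have h2 : (s + l).gcd (2 * s) ∣ (s + l).gcd (2 * l) := by
      refine Nat.dvd_gcd (Nat.gcd_dvd_left _ _) ?_
      have h3 := (Nat.gcd_dvd_left (s + l) (2 * s)).mul_left 2
      rw [mul_add] at h3
      exact (Nat.dvd_add_right (Nat.gcd_dvd_right _ _)).1 h3
    rw [hd'] at h2
    exact pow_prime_pow_eq_self_of_dvd (h2.trans (Nat.gcd_dvd_left s l)) h1
  root := by
    obtain ⟨u, h1, h2⟩ := exists_sq_eq_of_pow_eq_one (F := F) hodd hF (even_two_mul s) hd
      (y := -1) (Even.neg_one_pow (Nat.Odd.sub_odd hodd odd_one))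
    exact ⟨u, pow_prime_pow_eq_self_of_dvd (Nat.gcd_dvd_left s l) h1,
      pow_prime_pow_eq_self_of_dvd (Nat.gcd_dvd_right s l) h1, h2⟩
  τ := Algebra.trace (ZMod p) F
  χ_eq _ := rfl
  exists_sq y hy := by
    obtain ⟨u, h1, h2⟩ := exists_sq_eq_of_pow_eq_one (F := F) hodd hF (even_two_mul s) hd
      (y := algebraMap (ZMod p) F y) (by
        rw [← map_pow, ZMod.pow_card_sub_one_eq_one hy, map_one])
    exact ⟨u, pow_prime_pow_eq_self_of_dvd (Nat.gcd_dvd_left s l) h1,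
      pow_prime_pow_eq_self_of_dvd (Nat.gcd_dvd_right s l) h1, h2⟩

variable [DecidableEq F] {s l : ℕ} (hodd : Odd p) (hF : Fintype.card F = p ^ (2 * s))
  (hd' : (s + l).gcd (2 * l) = s.gcd l) (hd : Even (s.gcd l))

lemma frobeniusTwist_bar (x : F) : (frobeniusTwist s l hodd hF hd' hd).bar x = x ^ p ^ s := rfl

lemma card_frobeniusTwist_E : #(frobeniusTwist s l hodd hF hd' hd).E = p ^ s :=
  card_filter_pow_prime_pow_eq_self hF (Dvd.intro_left 2 rfl)

lemma card_frobeniusTwist_R : #(frobeniusTwist s l hodd hF hd' hd).R = p ^ s.gcd l := by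
  rw [← card_filter_pow_prime_pow_eq_self hF ((Nat.gcd_dvd_left s l).mul_left 2)]
  congr 1
  ext x
  rw [Twist.mem_R, mem_filter]
  simp only [mem_univ, true_and]
  exact ⟨fun h => pow_prime_pow_gcd_eq_self h.1 h.2,
    fun h => ⟨pow_prime_pow_eq_self_of_dvd (Nat.gcd_dvd_left s l) h,
      pow_prime_pow_eq_self_of_dvd (Nat.gcd_dvd_right s l) h⟩⟩

lemma suppw_eq_supp {v : F × F × F × ZMod p} (hv : v.1 ^ p ^ s = v.1) :
    suppw p s l v.1 v.2.1 v.2.2.1 v.2.2.2 = (frobeniusTwist s l hodd hF hd' hd).supp v := by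
  have h2 := (frobeniusTwist s l hodd hF hd' hd).two
  have hadd : ∀ x y : F, trp p (2 * s) (x + y) = trp p (2 * s) x + trp p (2 * s) y := by
    intro x y
    simp only [← algebraMap_trace_eq_trp hF, map_add]
  ext x
  rw [suppw, mem_filter, LinearTwist.mem_supp, ← map_ne_zero (algebraMap (ZMod p) F)]
  simp only [mem_univ, true_and]
  have hN : (2⁻¹ * v.1 * (x * x ^ p ^ s)) ^ p ^ s = 2⁻¹ * v.1 * (x * x ^ p ^ s) := by
    have := (frobeniusTwist s l hodd hF hd' hd).bar_mul_bar x
    have h3 : ((2 : F)⁻¹) ^ p ^ s = 2⁻¹ := by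
      have := map_ofNat (frobeniusTwist s l hodd hF hd' hd).bar 2
      rw [frobeniusTwist_bar] at this
      rw [inv_pow, this]
    rw [frobeniusTwist_bar, frobeniusTwist_bar] at this
    rw [mul_pow, mul_pow, hv, this, h3]
  have e : cword p s l v.1 v.2.1 v.2.2.1 v.2.2.2 x =
      algebraMap (ZMod p) F ((frobeniusTwist s l hodd hF hd' hd).word v x) := by
    have h4 : algebraMap (ZMod p) F v.2.2.2 = ZMod.cast v.2.2.2 :=
      DFunLike.congr_fun (Subsingleton.elim (algebraMap (ZMod p) F)
        (ZMod.castHom (dvd_refl p) F)) v.2.2.2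
    have h5 : algebraMap (ZMod p) F ((frobeniusTwist s l hodd hF hd' hd).word v x) =
        trp p (2 * s) (2⁻¹ * v.1 * (x * x ^ p ^ s) + v.2.1 * (x * x ^ p ^ l) + v.2.2.1 * x) +
          ZMod.cast v.2.2.2 := by
      rw [← algebraMap_trace_eq_trp hF, ← h4, ← map_add]
      rfl
    have h6 : trp p s (v.1 * x ^ (p ^ s + 1)) = trp p (2 * s) (2⁻¹ * v.1 * (x * x ^ p ^ s)) := by
      have h7 : v.1 * x ^ (p ^ s + 1) = 2⁻¹ * v.1 * (x * x ^ p ^ s) +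
          2⁻¹ * v.1 * (x * x ^ p ^ s) := by
        field_simp
        ring
      rw [trp_add_self hN, h7, trp, trp, Finset.mul_sum]
      refine Finset.sum_congr rfl fun i _ => ?_
      rw [add_pow_char_pow, two_mul]
    rw [h5, cword, h6, add_assoc (2⁻¹ * v.1 * _), hadd (2⁻¹ * v.1 * _)]
    congr 4
    ring
  rw [e]

end FrobeniusTwist

end Auxiliary

theorem stmt15 (p s l : ℕ) [Fact p.Prime] (F : Type) [Field F] [Fintype F] [DecidableEq F]
    [CharP F p] (hodd : Odd p) (hs : 2 ≤ s) (hl1 : 1 ≤ l) (hls : l ≠ s)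
    (hl2 : l ≤ 2 * s - 1) (hF : Fintype.card F = p ^ (2 * s)) (d : ℕ)
    (hd : Nat.gcd s l = d) (hd' : Nat.gcd (s + l) (2 * l) = d) (hdeven : Even d) :
    (∀ S ∈ (((Finset.univ : Finset (F × F × F × ZMod p)).filter fun t =>
        t.1 ^ p ^ s = t.1 ∧ (suppw p s l t.1 t.2.1 t.2.2.1 t.2.2.2).card
            = p ^ (s - 1) * (p - 1) * (p ^ s - 1)).image
        fun t => suppw p s l t.1 t.2.1 t.2.2.1 t.2.2.2),
      S.card = p ^ (s - 1) * (p - 1) * (p ^ s - 1)) ∧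
    ∀ x y : F, x ≠ y →
      (((((Finset.univ : Finset (F × F × F × ZMod p)).filter fun t =>
        t.1 ^ p ^ s = t.1 ∧ (suppw p s l t.1 t.2.1 t.2.2.1 t.2.2.2).card
            = p ^ (s - 1) * (p - 1) * (p ^ s - 1)).image
        fun t => suppw p s l t.1 t.2.1 t.2.2.1 t.2.2.2).filter
        fun S => x ∈ S ∧ y ∈ S).card : ℚ)
        = (p : ℚ) ^ (s + d - 1) * ((p : ℚ) ^ (s - 1) * ((p : ℚ) - 1) * ((p : ℚ) ^ s - 1) - 1)
          * ((p : ℚ) ^ (2 * s) - 1) / (2 * ((p : ℚ) ^ d + 1)) := by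
  have hp : p.Prime := Fact.out
  refine ⟨fun S hS => ?_, fun x y hxy => ?_⟩
  · obtain ⟨v, hv, rfl⟩ := Finset.mem_image.1 hS
    exact (Finset.mem_filter.1 hv).2.2
  subst hd
  let _ := ZMod.algebra F p
  set t := frobeniusTwist s l hodd hF hd' hdeven
  have hP : p ^ s = p * p ^ (s - 1) := by
    rw [← pow_succ', Nat.sub_add_cancel (by omega)]
  have hq : p ^ (2 * s) = (p * p ^ (s - 1)) ^ 2 := by rw [← hP, ← pow_mul, mul_comm]
  have hF' := hF.trans hq
  have hd1 : 1 ≤ s.gcd l := Nat.gcd_pos_of_pos_left _ (by omega)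
  have hds : s.gcd l < s := by
    refine lt_of_le_of_ne (Nat.gcd_le_left _ (by omega)) fun h => ?_
    obtain ⟨k, hk⟩ := Nat.gcd_eq_left_iff_dvd.1 h
    have hk2 : k < 2 := by
      by_contra! h2
      have := Nat.mul_le_mul_left s h2
      omega
    interval_cases k <;> omega
  have hblocks : (((Finset.univ : Finset (F × F × F × ZMod p)).filter fun t =>
        t.1 ^ p ^ s = t.1 ∧ (suppw p s l t.1 t.2.1 t.2.2.1 t.2.2.2).card
            = p ^ (s - 1) * (p - 1) * (p ^ s - 1)).image
        fun t => suppw p s l t.1 t.2.1 t.2.2.1 t.2.2.2) = t.blocks (p * p ^ (s - 1)) := by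
    have hfil : ((Finset.univ : Finset (F × F × F × ZMod p)).filter fun t =>
        t.1 ^ p ^ s = t.1 ∧ (suppw p s l t.1 t.2.1 t.2.2.1 t.2.2.2).card
            = p ^ (s - 1) * (p - 1) * (p ^ s - 1)) = t.heavy (p * p ^ (s - 1)) := by
      ext v
      rw [t.mem_heavy_iff_card_supp (Nat.one_le_pow _ _ hp.pos) hF', Finset.mem_filter, ← hP]
      simp only [Finset.mem_univ, true_and]
      refine and_congr_right fun hv => ?_
      rw [suppw_eq_supp hodd hF hd' hdeven hv]
    rw [hfil, LinearTwist.blocks]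
    refine Finset.image_congr fun v hv => ?_
    exact suppw_eq_supp hodd hF hd' hdeven (Finset.mem_filter.1 hv).2.1
  rw [hblocks, t.card_blocks_pair_eq (r := p ^ s.gcd l) ?_ (dvd_pow_self p (by omega))
    (Nat.one_le_pow _ _ hp.pos) (Nat.pow_le_pow_right hp.pos (by omega))
    ((card_frobeniusTwist_E hodd hF hd' hdeven).trans hP)
    (card_frobeniusTwist_R hodd hF hd' hdeven) hF' hxy]
  · have e1 : (p : ℚ) * p ^ (s - 1) = p ^ s := by exact_mod_cast hP.symm
    have e2 : (p : ℚ) ^ s.gcd l * p ^ (s - 1) = p ^ (s + s.gcd l - 1) := by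
      rw [← pow_add]; congr 1; omega
    push_cast
    rw [e1, e2, ← pow_mul, mul_comm s 2]
  · rintro rfl
    exact absurd hodd (by decide)
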